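/- arXiv:1412.7778 — 5 statements merged into one kernel-verified Lean document; each statement's English description precedes it below -/
import Mathlib

section
/- Let T be a nonempty finite index set, let η : Ω → ℝ^T be a random vector on a probability space (Ω, 𝓕, P) each of whose coordinates η_t takes values in {0,1}, and let g : ℝ^T → ℝ be twice continuously differentiable with gradient g'(0) and Hessian matrix g''(0) at the origin. Then, as ε → 0, ln E[exp(g(ε·η))] = g(0) + (g'(0)ᵀ E[η]) ε + (1/2)( E[ηᵀ g''(0) η] + g'(0)ᵀ Cov(η) g'(0) ) ε² + o(ε²), i.e., the difference between the left side and the displayed quadratic polynomial in ε is o(ε²) as ε → 0. -/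
open MeasureTheory Asymptotics Filter Topology

/-- The second-order Peano form of Taylor's theorem at `0`. -/
theorem ContDiff.sub_taylor_two_isLittleO {f f' : ℝ → ℝ} {c : ℝ} (hf : ContDiff ℝ 2 f)
    (hf' : ∀ x, HasDerivAt f (f' x) x) (hc : HasDerivAt f' c 0) :
    (fun ε : ℝ => f ε - (f 0 + f' 0 * ε + c / 2 * ε ^ 2)) =o[𝓝 0] fun ε : ℝ => ε ^ 2 := by
  have hderiv : deriv f = f' := funext fun x => (hf' x).deriv
  have h := taylor_isLittleO_univ (x₀ := 0) (n := 2) hf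
  simp only [sub_zero] at h
  refine h.congr_left fun ε => ?_
  simp only [taylorWithinEval_succ, taylor_within_zero_eval, iteratedDerivWithin_univ,
    iteratedDeriv_succ, iteratedDeriv_zero, hderiv, hc.deriv, smul_eq_mul]
  norm_num
  ring

/-- The law of a binary process is a finite mixture of point masses. -/
theorem exists_integral_comp_eq_sum_of_binary
    {T : Type*} [Fintype T]
    {Ω : Type*} [MeasurableSpace Ω] (P : Measure Ω) [IsProbabilityMeasure P]
    (η : Ω → T → ℝ) (hη : Measurable η)
    (hbin : ∀ t : T, ∀ᵐ ω ∂P, η ω t = 0 ∨ η ω t = 1) :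
    ∃ (p : Set T → ℝ) (x : Set T → T → ℝ), (∀ A, 0 ≤ p A) ∧
      ∀ F : (T → ℝ) → ℝ, ∫ ω, F (η ω) ∂P = ∑ A, p A * F (x A) := by
  classical
  let x : Set T → T → ℝ := fun A => A.indicator 1
  have hmeas : ∀ A, MeasurableSet {ω | η ω = x A} := fun A => hη (measurableSet_singleton (x A))
  refine ⟨fun A => P.real {ω | η ω = x A}, x, fun A => measureReal_nonneg, fun F => ?_⟩
  have hx : Function.Injective x := fun _ _ h => Set.indicator_one_inj ℝ h
  have hae : (fun ω => F (η ω)) =ᵐ[P]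
      fun ω => ∑ A, {ω | η ω = x A}.indicator (fun _ => F (x A)) ω := by
    filter_upwards [ae_all_iff.2 hbin] with ω hω
    have hA : η ω = x {t | η ω t = 1} := by
      ext t
      rcases hω t with h | h <;> simp [x, h]
    rw [Finset.sum_eq_single {t | η ω t = 1}]
    · rw [Set.indicator_of_mem (show ω ∈ {ω | η ω = x _} from hA), ← hA]
    · intro B _ hB
      exact Set.indicator_of_notMem (fun h => hB (hx (h.symm.trans hA))) _
    · simp
  rw [integral_congr_ae hae, integral_finsetSum]
  · exact Finset.sum_congr rfl fun A _ => by
      rw [integral_indicator_const _ (hmeas A), smul_eq_mul]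
  · exact fun A _ => (integrable_const _).indicator (hmeas A)

/-- Second-order Taylor expansion of the logarithm of a finite mixture of exponentials. -/
theorem log_sum_exp_taylor_two_isLittleO
    {E ι : Type*} [NormedAddCommGroup E] [NormedSpace ℝ E] [Fintype ι]
    {p : ι → ℝ} (hp : ∀ i, 0 ≤ p i) (hp1 : ∑ i, p i = 1) (x : ι → E)
    {g : E → ℝ} (hg : ContDiff ℝ 2 g) :
    (fun ε : ℝ => Real.log (∑ i, p i * Real.exp (g (ε • x i)))
        - (g 0 + (∑ i, p i * fderiv ℝ g 0 (x i)) * ε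
          + (∑ i, p i * (fderiv ℝ g 0 (x i) ^ 2 + fderiv ℝ (fderiv ℝ g) 0 (x i) (x i))
              - (∑ i, p i * fderiv ℝ g 0 (x i)) ^ 2) / 2 * ε ^ 2))
      =o[𝓝 (0 : ℝ)] (fun ε : ℝ => ε ^ 2) := by
  set M : ℝ → ℝ := fun ε => ∑ i, p i * Real.exp (g (ε • x i)) with hM
  set M' : ℝ → ℝ := fun ε => ∑ i, p i * (Real.exp (g (ε • x i)) * fderiv ℝ g (ε • x i) (x i))
    with hM'
  have hpos : ∀ ε, 0 < M ε := fun ε => by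
    obtain ⟨i, hi⟩ : ∃ i, p i ≠ 0 := by
      by_contra! h
      simp [h] at hp1
    exact Finset.sum_pos' (fun j _ => mul_nonneg (hp j) (Real.exp_pos _).le)
      ⟨i, Finset.mem_univ i, mul_pos ((hp i).lt_of_ne' hi) (Real.exp_pos _)⟩
  have hline : ∀ i (ε : ℝ), HasDerivAt (fun ε : ℝ => ε • x i) (x i) ε := fun i ε => by
    simpa using (hasDerivAt_id ε).smul_const (x i)
  have hexp : ∀ i (ε : ℝ), HasDerivAt (fun ε : ℝ => Real.exp (g (ε • x i)))
      (Real.exp (g (ε • x i)) * fderiv ℝ g (ε • x i) (x i)) ε := fun i ε =>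
    (((hg.differentiable (by norm_num)) (ε • x i)).hasFDerivAt.comp_hasDerivAt ε
      (hline i ε)).exp
  have hMd : ∀ ε, HasDerivAt M (M' ε) ε := fun ε =>
    HasDerivAt.fun_sum fun i _ => (hexp i ε).const_mul (p i)
  have hg' : Differentiable ℝ (fderiv ℝ g) :=
    (hg.fderiv_right (m := 1) (by norm_num)).differentiable (by norm_num)
  have hM'd : HasDerivAt M' (∑ i, p i * (Real.exp (g 0) * fderiv ℝ g 0 (x i) * fderiv ℝ g 0 (x i)
      + Real.exp (g 0) * fderiv ℝ (fderiv ℝ g) 0 (x i) (x i))) 0 := by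
    refine HasDerivAt.fun_sum fun i _ => HasDerivAt.const_mul (p i) ?_
    have h2 : HasDerivAt (fun ε : ℝ => fderiv ℝ g (ε • x i) (x i))
        (fderiv ℝ (fderiv ℝ g) ((0 : ℝ) • x i) (x i) (x i)) 0 := by
      have h1 : HasDerivAt (fun ε : ℝ => fderiv ℝ g (ε • x i))
          (fderiv ℝ (fderiv ℝ g) ((0 : ℝ) • x i) (x i)) 0 :=
        (hg' ((0 : ℝ) • x i)).hasFDerivAt.comp_hasDerivAt (0 : ℝ) (hline i 0)
      exact ((ContinuousLinearMap.apply ℝ ℝ (x i)).hasFDerivAt).comp_hasDerivAt (0 : ℝ) h1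
    simpa using (hexp i 0).fun_mul h2
  have hM0 : M 0 = Real.exp (g 0) := by simp [hM, ← Finset.sum_mul, hp1]
  have hM'0 : M' 0 = Real.exp (g 0) * ∑ i, p i * fderiv ℝ g 0 (x i) := by
    simp only [hM', zero_smul, Finset.mul_sum]
    exact Finset.sum_congr rfl fun i _ => by ring
  have hlog : ContDiff ℝ 2 fun ε => Real.log (M ε) := by
    refine ContDiff.log ?_ fun ε => (hpos ε).ne'
    fun_prop
  refine (hlog.sub_taylor_two_isLittleO (fun ε => (hMd ε).log (hpos ε).ne')
    (hM'd.fun_div (hMd 0) (hpos 0).ne')).congr_left fun ε => ?_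
  have hsum : ∑ i, p i * (Real.exp (g 0) * fderiv ℝ g 0 (x i) * fderiv ℝ g 0 (x i)
      + Real.exp (g 0) * fderiv ℝ (fderiv ℝ g) 0 (x i) (x i))
      = Real.exp (g 0)
        * ∑ i, p i * (fderiv ℝ g 0 (x i) ^ 2 + fderiv ℝ (fderiv ℝ g) 0 (x i) (x i)) := by
    rw [Finset.mul_sum]
    exact Finset.sum_congr rfl fun i _ => by ring
  have hne := (Real.exp_pos (g 0)).ne'
  rw [hsum, hM'0, hM0, Real.log_exp]
  field_simp
  ring

/-- Lemma 1 (eq. (3), "energy"): second-order Taylor expansion of the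
log-moment generating functional `ln E[exp (g (ε • η))]` for a binary
process `η` and a `C²` function `g`. -/
theorem logMGF_taylor_binary
    {T : Type*} [Fintype T] [Nonempty T]
    {Ω : Type*} [MeasurableSpace Ω] (P : Measure Ω) [IsProbabilityMeasure P]
    (η : Ω → T → ℝ) (hη : Measurable η)
    (hbin : ∀ t : T, ∀ᵐ ω ∂P, η ω t = 0 ∨ η ω t = 1)
    (g : (T → ℝ) → ℝ) (hg : ContDiff ℝ 2 g)
    (γ : T → ℝ) (hγ : ∀ v : T → ℝ, fderiv ℝ g 0 v = ∑ s, γ s * v s)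
    (H : T → T → ℝ)
    (hH : ∀ v w : T → ℝ,
      fderiv ℝ (fderiv ℝ g) 0 v w = ∑ s, ∑ u, v s * H s u * w u) :
    (fun ε : ℝ =>
        Real.log (∫ ω, Real.exp (g (ε • η ω)) ∂P)
          - (g 0
            + (∑ s, γ s * ∫ ω, η ω s ∂P) * ε
            + (1 / 2) *
              ((∫ ω, ∑ s, ∑ u, η ω s * H s u * η ω u ∂P)
                + ∑ s, ∑ u, γ s *
                    ((∫ ω, η ω s * η ω u ∂P)
                      - (∫ ω, η ω s ∂P) * (∫ ω, η ω u ∂P)) * γ u) * ε ^ 2))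
      =o[𝓝 (0 : ℝ)] (fun ε : ℝ => ε ^ 2) := by
  classical
  obtain ⟨p, x, hp, hint⟩ := exists_integral_comp_eq_sum_of_binary P η hη hbin
  have hp1 : ∑ A, p A = 1 := by simpa using (hint fun _ => 1).symm
  refine (log_sum_exp_taylor_two_isLittleO hp hp1 x hg).congr_left fun ε => ?_
  have h1 : ∀ s, ∫ ω, η ω s ∂P = ∑ A, p A * x A s := fun s => hint fun y => y s
  have h2 : ∀ s u, ∫ ω, η ω s * η ω u ∂P = ∑ A, p A * (x A s * x A u) :=
    fun s u => hint fun y => y s * y u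
  have hmean : ∑ s, γ s * ∑ A, p A * x A s = ∑ A, p A * ∑ s, γ s * x A s := by
    simp only [Finset.mul_sum]
    rw [Finset.sum_comm]
    exact Finset.sum_congr rfl fun A _ => Finset.sum_congr rfl fun s _ => by ring
  have hcov : ∑ s, ∑ u, γ s * ((∑ A, p A * (x A s * x A u))
        - (∑ A, p A * x A s) * (∑ A, p A * x A u)) * γ u
      = ∑ A, p A * (∑ s, γ s * x A s) ^ 2 - (∑ A, p A * ∑ s, γ s * x A s) ^ 2 := by
    have hsq : ∑ s, ∑ u, γ s * (∑ A, p A * (x A s * x A u)) * γ u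
        = ∑ A, p A * (∑ s, γ s * x A s) ^ 2 := by
      simp only [sq, Finset.mul_sum, Finset.sum_mul]
      rw [Finset.sum_comm_cycle]
      refine Finset.sum_congr rfl fun A _ => ?_
      rw [Finset.sum_comm]
      exact Finset.sum_congr rfl fun s _ => Finset.sum_congr rfl fun u _ => by ring
    rw [← hsq, ← hmean, sq, Finset.sum_mul_sum]
    simp only [← Finset.sum_sub_distrib]
    exact Finset.sum_congr rfl fun s _ => Finset.sum_congr rfl fun u _ => by ring
  rw [hint fun y => Real.exp (g (ε • y)), hint fun y => ∑ s, ∑ u, y s * H s u * y u]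
  simp only [h1, h2]
  rw [hcov, hmean]
  simp only [hγ, hH, mul_add, Finset.sum_add_distrib]
  ring
end

section
/- Let T be a nonempty finite index set, let η : Ω → ℝ^T be a binary process on a probability space (Ω, 𝓕, P), fix t ∈ T with 0 < P(η_t = 1) < 1, and let g : ℝ^T → ℝ be twice continuously differentiable with gradient γ and Hessian H at the origin. For i ∈ {0,1} let E_{i}[·] and Cov_{i}(·) denote expectation and covariance conditional on the event {η_t = i}, and for ε ∈ ℝ define r(ε) = ln( P(η_t = 1)/P(η_t = 0) ) + ln E_{1}[exp(g(ε·η))] − ln E_{0}[exp(g(ε·η))]. Then, as ε → 0, r(ε) = ln( P(η_t = 1)/P(η_t = 0) ) + γᵀ( E_{1}[η] − E_{0}[η] ) ε + (1/2)( E_{1}[ηᵀ H η] − E_{0}[ηᵀ H η] ) ε² + (1/2) γᵀ( Cov_{1}(η) − Cov_{0}(η) ) γ ε² + o(ε²). -/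
open MeasureTheory ProbabilityTheory Asymptotics Filter Topology

section Taylor

variable {E : Type*} [NormedAddCommGroup E]

theorem ContDiff.sub_second_order_isLittleO [NormedSpace ℝ E] {g : E → ℝ} (hg : ContDiff ℝ 2 g) :
    (fun x => g x - g 0 - (fderiv ℝ g 0 x + (1 / 2) * fderiv ℝ (fderiv ℝ g) 0 x x))
      =o[𝓝 0] fun x => ‖x‖ ^ 2 := by
  set L := fderiv ℝ g 0
  set B := fderiv ℝ (fderiv ℝ g) 0
  have hsymm (v w : E) : B v w = B w v :=
    hg.contDiffAt.isSymmSndFDerivAt (by simp) v w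
  have hdiff : Differentiable ℝ g := hg.differentiable (by norm_num)
  have hderiv : HasFDerivAt (fderiv ℝ g) B 0 :=
    ((hg.fderiv_right (m := 1) (by norm_num)).differentiable (by norm_num) 0).hasFDerivAt
  have hremainder (x : E) : HasFDerivAt (fun x => g x - (L x + (1 / 2) * B x x))
      (fderiv ℝ g x - L - B x) x := by
    have hquad : HasFDerivAt (fun x => B x x) (B x + B.flip x) x :=
      (B.hasFDerivAt (x := x)).clm_apply (hasFDerivAt_id x)
    refine ((hdiff x).hasFDerivAt.sub
      (L.hasFDerivAt.add (hquad.const_mul (1 / 2)))).congr_fderiv ?_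
    ext v
    simp only [sub_apply, add_apply, smul_apply, ContinuousLinearMap.flip_apply, smul_eq_mul,
      hsymm v x]
    ring
  have h := convex_univ.isLittleO_pow_succ (x₀ := (0 : E)) (n := 1) (Set.mem_univ _)
    (fun x _ => (hremainder x).hasFDerivWithinAt) (by
      simpa [nhdsWithin_univ] using (hasFDerivAt_iff_isLittleO_nhds_zero.1 hderiv).norm_right)
  rw [nhdsWithin_univ] at h
  refine h.congr (fun x => ?_) (fun x => by simp)
  simp only [map_zero]
  ring

end Taylor

section Composition

variable {α : Type*} {l : Filter α} {u a b n : α → ℝ}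

theorem isBigO_of_sub_isLittleO_sq (hn : Tendsto n l (𝓝 0)) (ha : a =O[l] n)
    (hb : b =O[l] fun x => n x ^ 2) (hu : (fun x => u x - (a x + b x)) =o[l] fun x => n x ^ 2) :
    u =O[l] n ∧ (fun x => u x ^ 2 - a x ^ 2) =o[l] fun x => n x ^ 2 := by
  have hsq : (fun x => n x ^ 2) =o[l] n := by
    simpa only [Function.comp_def, id] using (isLittleO_pow_id one_lt_two).comp_tendsto hn
  have hua : (fun x => u x - a x) =O[l] fun x => n x ^ 2 :=
    (hu.isBigO.add hb).congr_left fun x => by ring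
  have huo : u =O[l] n := ((hua.trans hsq.isBigO).add ha).congr_left fun x => by ring
  refine ⟨huo, ?_⟩
  exact ((hua.trans_isLittleO hsq).mul_isBigO (huo.add ha)).congr
    (fun x => by ring) (fun x => by ring)

theorem exp_sub_second_order_isLittleO (hn : Tendsto n l (𝓝 0)) (ha : a =O[l] n)
    (hb : b =O[l] fun x => n x ^ 2) (hu : (fun x => u x - (a x + b x)) =o[l] fun x => n x ^ 2) :
    (fun x => Real.exp (u x) - (1 + a x + (b x + (1 / 2) * a x ^ 2)))
      =o[l] fun x => n x ^ 2 := by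
  obtain ⟨huo, hsq⟩ := isBigO_of_sub_isLittleO_sq hn ha hb hu
  have h := ((Real.exp_sub_sum_range_succ_isLittleO_pow 2).comp_tendsto
    (huo.trans_tendsto hn)).trans_isBigO (huo.pow 2)
  refine ((h.add hu).add (hsq.const_mul_left (1 / 2))).congr_left fun x => ?_
  simp [Finset.sum_range_succ]
  ring

theorem Real.log_one_add_sub_isBigO :
    (fun y : ℝ => Real.log (1 + y) - (y - (1 / 2) * y ^ 2)) =O[𝓝 0] fun y => y ^ 3 := by
  refine IsBigO.of_bound 2 ?_
  filter_upwards [Metric.ball_mem_nhds (0 : ℝ) (by norm_num : (0 : ℝ) < 1 / 2)] with y hy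
  rw [mem_ball_zero_iff, Real.norm_eq_abs] at hy
  have h := Real.abs_log_sub_add_sum_range_le (x := -y) (by rw [abs_neg]; linarith) 2
  rw [abs_neg] at h
  simp only [Real.norm_eq_abs, abs_pow]
  calc _ = |(∑ i ∈ Finset.range 2, (-y) ^ (i + 1) / ((i : ℝ) + 1)) + Real.log (1 - -y)| := by
        congr 1
        simp [Finset.sum_range_succ]
        ring
    _ ≤ _ := h
    _ ≤ _ := by
        rw [div_le_iff₀ (by linarith)]
        change |y| ^ 3 ≤ _
        nlinarith [mul_nonneg (pow_nonneg (abs_nonneg y) 3) (by linarith : 0 ≤ 1 - 2 * |y|)]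

theorem log_sub_second_order_isLittleO (hn : Tendsto n l (𝓝 0)) (ha : a =O[l] n)
    (hb : b =O[l] fun x => n x ^ 2)
    (hu : (fun x => u x - (1 + a x + b x)) =o[l] fun x => n x ^ 2) :
    (fun x => Real.log (u x) - (a x + (b x - (1 / 2) * a x ^ 2))) =o[l] fun x => n x ^ 2 := by
  replace hu : (fun x => (u x - 1) - (a x + b x)) =o[l] fun x => n x ^ 2 :=
    hu.congr_left fun x => by ring
  obtain ⟨huo, hsq⟩ := isBigO_of_sub_isLittleO_sq hn ha hb hu
  have h := ((Real.log_one_add_sub_isBigO.trans_isLittleO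
    (isLittleO_pow_pow (by norm_num : 2 < 3))).comp_tendsto
      (huo.trans_tendsto hn)).trans_isBigO (huo.pow 2)
  refine ((h.add hu).sub (hsq.const_mul_left (1 / 2))).congr_left fun x => ?_
  simp only [Function.comp_apply, add_sub_cancel]
  ring

end Composition

section Expectation

variable {Ω E : Type*} [MeasurableSpace Ω] {μ : Measure Ω} [NormedAddCommGroup E]
  [NormedSpace ℝ E] {X : Ω → E}

theorem integral_comp_smul_isLittleO [IsProbabilityMeasure μ] (hX : ∀ᵐ ω ∂μ, ‖X ω‖ ≤ 1)
    {R : E → ℝ} {k : ℕ} (hR : R =o[𝓝 0] fun x => ‖x‖ ^ k) :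
    (fun ε : ℝ => ∫ ω, R (ε • X ω) ∂μ) =o[𝓝 0] fun ε => ε ^ k := by
  rw [isLittleO_iff] at hR ⊢
  intro c hc
  obtain ⟨δ, hδ, hball⟩ := Metric.eventually_nhds_iff_ball.1 (hR hc)
  filter_upwards [Metric.ball_mem_nhds (0 : ℝ) hδ] with ε hε
  rw [mem_ball_zero_iff] at hε
  have hle : ∀ᵐ ω ∂μ, ‖R (ε • X ω)‖ ≤ c * ‖ε ^ k‖ := by
    filter_upwards [hX] with ω hω
    have hnorm : ‖ε • X ω‖ ≤ ‖ε‖ := by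
      rw [norm_smul]
      exact mul_le_of_le_one_right (norm_nonneg _) hω
    refine (hball _ (mem_ball_zero_iff.2 (hnorm.trans_lt hε))).trans ?_
    rw [norm_pow, norm_norm, norm_pow]
    gcongr
  simpa using norm_integral_le_of_norm_le_const hle

variable [MeasurableSpace E] [BorelSpace E] [FiniteDimensional ℝ E]

theorem Continuous.integrable_comp_of_ae_norm_le [IsFiniteMeasure μ] {f : E → ℝ}
    (hf : Continuous f) (hXm : AEMeasurable X μ) {r : ℝ} (hX : ∀ᵐ ω ∂μ, ‖X ω‖ ≤ r) :
    Integrable (fun ω => f (X ω)) μ := by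
  have : ProperSpace E := FiniteDimensional.proper ℝ E
  obtain ⟨C, hC⟩ := (isCompact_closedBall (0 : E) r).exists_bound_of_continuousOn hf.continuousOn
  refine Integrable.of_bound (hf.measurable.comp_aemeasurable hXm).aestronglyMeasurable C ?_
  filter_upwards [hX] with ω hω
  exact hC _ (mem_closedBall_zero_iff.2 hω)

theorem log_integral_exp_comp_smul_isLittleO [IsProbabilityMeasure μ] (hXm : AEMeasurable X μ)
    (hX : ∀ᵐ ω ∂μ, ‖X ω‖ ≤ 1) {g : E → ℝ} (hg : ContDiff ℝ 2 g) :
    (fun ε : ℝ => Real.log (∫ ω, Real.exp (g (ε • X ω)) ∂μ)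
      - (g 0 + ((∫ ω, fderiv ℝ g 0 (X ω) ∂μ) * ε
        + (1 / 2) * ((∫ ω, fderiv ℝ (fderiv ℝ g) 0 (X ω) (X ω) ∂μ)
          + (∫ ω, fderiv ℝ g 0 (X ω) ^ 2 ∂μ) - (∫ ω, fderiv ℝ g 0 (X ω) ∂μ) ^ 2) * ε ^ 2)))
      =o[𝓝 0] fun ε => ε ^ 2 := by
  set L := fderiv ℝ g 0
  set B := fderiv ℝ (fderiv ℝ g) 0
  have hquad : (fun x => (1 / 2) * B x x) =O[𝓝 0] fun x => ‖x‖ ^ 2 := by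
    refine IsBigO.const_mul_left (IsBigO.of_bound ‖B‖ (Eventually.of_forall fun x => ?_)) _
    simpa [pow_two, mul_assoc] using B.le_opNorm₂ x x
  have hexp := integral_comp_smul_isLittleO hX
    (exp_sub_second_order_isLittleO tendsto_norm_zero (L.isBigO_id _).norm_right hquad
      hg.sub_second_order_isLittleO)
  have hint {f : E → ℝ} (hf : Continuous f) : Integrable (fun ω => f (X ω)) μ :=
    hf.integrable_comp_of_ae_norm_le hXm hX
  have hL := hint L.continuous
  have hB := hint (f := fun x => B x x) (by fun_prop)
  have hL2 := hint (f := fun x => L x ^ 2) (by fun_prop)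
  have hmoment : (fun ε : ℝ => (∫ ω, Real.exp (g (ε • X ω) - g 0) ∂μ)
      - (1 + (∫ ω, L (X ω) ∂μ) * ε
        + (1 / 2) * ((∫ ω, B (X ω) (X ω) ∂μ) + ∫ ω, L (X ω) ^ 2 ∂μ) * ε ^ 2))
      =o[𝓝 0] fun ε => ε ^ 2 := by
    refine hexp.congr_left fun ε => ?_
    have hE := hint (f := fun x => Real.exp (g (ε • x) - g 0))
      (by have := hg.continuous; fun_prop)
    simp only [map_smul, smul_apply, smul_eq_mul, mul_pow]
    have hlin := (integrable_const (1 : ℝ)).fun_add (hL.const_mul ε)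
    have hBε := ((hB.const_mul ε).const_mul ε).const_mul (1 / 2)
    have hL2ε := (hL2.const_mul (ε ^ 2)).const_mul (1 / 2)
    rw [integral_sub hE (hlin.fun_add (hBε.fun_add hL2ε)), integral_add hlin (hBε.fun_add hL2ε),
      integral_add (integrable_const 1) (hL.const_mul ε), integral_add hBε hL2ε]
    simp only [integral_const_mul, integral_const, probReal_univ, smul_eq_mul]
    ring
  have hlog := log_sub_second_order_isLittleO (n := fun ε : ℝ => ε) tendsto_id
    (isBigO_const_mul_self _ _ _) (isBigO_const_mul_self _ _ _) hmoment
  refine hlog.congr_left fun ε => ?_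
  have hpos : 0 < ∫ ω, Real.exp (g (ε • X ω)) ∂μ :=
    integral_exp_pos (hint (f := fun x => Real.exp (g (ε • x)))
      (by have := hg.continuous; fun_prop))
  simp only [Real.exp_sub, integral_div]
  rw [Real.log_div hpos.ne' (Real.exp_ne_zero _), Real.log_exp]
  ring

end Expectation

theorem log_integral_exp_comp_smul_isLittleO_pi {T Ω : Type*} [Fintype T] [MeasurableSpace Ω]
    {μ : Measure Ω} [IsProbabilityMeasure μ] {η : Ω → T → ℝ} (hη : AEMeasurable η μ)
    (hbound : ∀ᵐ ω ∂μ, ‖η ω‖ ≤ 1) {g : (T → ℝ) → ℝ} (hg : ContDiff ℝ 2 g)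
    {γ : T → ℝ} (hγ : ∀ v : T → ℝ, fderiv ℝ g 0 v = ∑ s, γ s * v s)
    {H : T → T → ℝ}
    (hH : ∀ v w : T → ℝ,
      fderiv ℝ (fderiv ℝ g) 0 v w = ∑ s, ∑ u, v s * H s u * w u) :
    (fun ε : ℝ => Real.log (∫ ω, Real.exp (g (ε • η ω)) ∂μ)
      - (g 0 + (∑ s, γ s * ∫ ω, η ω s ∂μ) * ε
        + (1 / 2) * (∫ ω, ∑ s, ∑ u, η ω s * H s u * η ω u ∂μ) * ε ^ 2
        + (1 / 2) * (∑ s, ∑ u, γ s * ((∫ ω, η ω s * η ω u ∂μ)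
          - (∫ ω, η ω s ∂μ) * (∫ ω, η ω u ∂μ)) * γ u) * ε ^ 2))
      =o[𝓝 0] fun ε => ε ^ 2 := by
  have hint {f : (T → ℝ) → ℝ} (hf : Continuous f) : Integrable (fun ω => f (η ω)) μ :=
    hf.integrable_comp_of_ae_norm_le hη hbound
  have hmean : ∫ ω, ∑ s, γ s * η ω s ∂μ = ∑ s, γ s * ∫ ω, η ω s ∂μ := by
    rw [integral_finsetSum _ fun s _ => hint (f := fun x => γ s * x s) (by fun_prop)]
    simp only [integral_const_mul]
  have hsq : ∫ ω, (∑ s, γ s * η ω s) ^ 2 ∂μ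
      = ∑ s, ∑ u, γ s * (∫ ω, η ω s * η ω u ∂μ) * γ u := by
    simp only [pow_two, Finset.sum_mul_sum]
    rw [integral_finsetSum _ fun s _ =>
      hint (f := fun x => ∑ u, γ s * x s * (γ u * x u)) (by fun_prop)]
    refine Finset.sum_congr rfl fun s _ => ?_
    rw [integral_finsetSum _ fun u _ =>
      hint (f := fun x => γ s * x s * (γ u * x u)) (by fun_prop)]
    refine Finset.sum_congr rfl fun u _ => ?_
    rw [← integral_const_mul, ← integral_mul_const]
    exact integral_congr_ae (Eventually.of_forall fun ω => by ring)
  refine (log_integral_exp_comp_smul_isLittleO hη hbound hg).congr_left fun ε => ?_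
  simp only [hγ, hH]
  have hcov : ∑ s, ∑ u, γ s * ((∫ ω, η ω s * η ω u ∂μ)
      - (∫ ω, η ω s ∂μ) * (∫ ω, η ω u ∂μ)) * γ u
      = (∫ ω, (∑ s, γ s * η ω s) ^ 2 ∂μ) - (∫ ω, ∑ s, γ s * η ω s ∂μ) ^ 2 := by
    rw [hsq, hmean, pow_two, Finset.sum_mul_sum, ← Finset.sum_sub_distrib]
    refine Finset.sum_congr rfl fun s _ => ?_
    rw [← Finset.sum_sub_distrib]
    exact Finset.sum_congr rfl fun u _ => by ring
  rw [hcov, hmean]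
  ring

/-- Theorem 1 (eq. (6), "PL-R"): second-order Taylor expansion in the signal
strength `ε` of the conditional log-likelihood ratio
`r(ε) = ln(P(η_t=1)/P(η_t=0)) + ln E₁[exp (g (ε • η))] − ln E₀[exp (g (ε • η))]`,
where `Eᵢ` denotes expectation conditional on `{η_t = i}`. -/
theorem cond_loglik_ratio_taylor
    {T : Type*} [Fintype T] [Nonempty T]
    {Ω : Type*} [MeasurableSpace Ω] (P : Measure Ω) [IsProbabilityMeasure P]
    (η : Ω → T → ℝ) (hη : Measurable η)
    (hbin : ∀ t : T, ∀ᵐ ω ∂P, η ω t = 0 ∨ η ω t = 1)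
    (t : T) (h0 : 0 < P {ω | η ω t = 1}) (h1 : P {ω | η ω t = 1} < 1)
    (g : (T → ℝ) → ℝ) (hg : ContDiff ℝ 2 g)
    (γ : T → ℝ) (hγ : ∀ v : T → ℝ, fderiv ℝ g 0 v = ∑ s, γ s * v s)
    (H : T → T → ℝ)
    (hH : ∀ v w : T → ℝ,
      fderiv ℝ (fderiv ℝ g) 0 v w = ∑ s, ∑ u, v s * H s u * w u) :
    (fun ε : ℝ =>
        (Real.log ((P {ω | η ω t = 1}).toReal / (P {ω | η ω t = 0}).toReal)
          + Real.log (∫ ω, Real.exp (g (ε • η ω)) ∂(P[|{ω | η ω t = 1}]))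
          - Real.log (∫ ω, Real.exp (g (ε • η ω)) ∂(P[|{ω | η ω t = 0}])))
        - (Real.log ((P {ω | η ω t = 1}).toReal / (P {ω | η ω t = 0}).toReal)
          + (∑ s, γ s * ((∫ ω, η ω s ∂(P[|{ω | η ω t = 1}]))
              - (∫ ω, η ω s ∂(P[|{ω | η ω t = 0}])))) * ε
          + (1 / 2) *
              ((∫ ω, ∑ s, ∑ u, η ω s * H s u * η ω u ∂(P[|{ω | η ω t = 1}]))
                - (∫ ω, ∑ s, ∑ u, η ω s * H s u * η ω u ∂(P[|{ω | η ω t = 0}])))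
              * ε ^ 2
          + (1 / 2) *
              (∑ s, ∑ u, γ s *
                (((∫ ω, η ω s * η ω u ∂(P[|{ω | η ω t = 1}]))
                    - (∫ ω, η ω s ∂(P[|{ω | η ω t = 1}]))
                      * (∫ ω, η ω u ∂(P[|{ω | η ω t = 1}])))
                  - ((∫ ω, η ω s * η ω u ∂(P[|{ω | η ω t = 0}]))
                    - (∫ ω, η ω s ∂(P[|{ω | η ω t = 0}]))
                      * (∫ ω, η ω u ∂(P[|{ω | η ω t = 0}])))) * γ u)
              * ε ^ 2))
      =o[𝓝 (0 : ℝ)] (fun ε : ℝ => ε ^ 2) := by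
  have hbound : ∀ᵐ ω ∂P, ‖η ω‖ ≤ 1 := by
    filter_upwards [ae_all_iff.2 hbin] with ω hω
    refine (pi_norm_le_iff_of_nonneg zero_le_one).2 fun s => ?_
    rcases hω s with h | h <;> simp [h]
  have hzero : P {ω | η ω t = 0} ≠ 0 := by
    intro h
    refine h1.ne ((measure_congr (eventuallyEq_univ.2 ?_)).trans measure_univ)
    filter_upwards [hbin t, measure_eq_zero_iff_ae_notMem.1 h] with ω hω hω0
    exact hω.resolve_left hω0
  have expansion (c : ℝ) (hc : P {ω | η ω t = c} ≠ 0) :=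
    haveI := cond_isProbabilityMeasure hc
    log_integral_exp_comp_smul_isLittleO_pi (μ := P[|{ω | η ω t = c}]) hη.aemeasurable
      (cond_absolutelyContinuous.ae_le hbound) hg hγ hH
  refine ((expansion 1 h0.ne').sub (expansion 0 hzero)).congr_left fun ε => ?_
  simp only [mul_sub, sub_mul, Finset.sum_sub_distrib]
  ring
end

section
/- Let T be a nonempty finite index set, let η : Ω → ℝ^T be a binary process on a probability space (Ω, 𝓕, P), fix t ∈ T and i ∈ {0,1} with P(η_t = i) > 0, and let g : ℝ^T → ℝ be twice continuously differentiable with gradient γ and Hessian H at the origin. Let E_{i}[·] and Cov_{i}(·) denote expectation and covariance conditional on the event {η_t = i}. Then, as ε → 0, ln E_{i}[exp(g(ε·η))] = g(0) + ( γᵀ E_{i}[η] ) ε + (1/2)( E_{i}[ηᵀ H η] + γᵀ Cov_{i}(η) γ ) ε² + o(ε²). -/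
open MeasureTheory ProbabilityTheory Asymptotics Filter Topology

/-- Second-order Taylor expansion with Peano remainder of a `C²` function at the origin. -/
theorem ContDiff.taylor_two_isLittleO {E : Type*} [NormedAddCommGroup E] [NormedSpace ℝ E]
    {g : E → ℝ} (hg : ContDiff ℝ 2 g) :
    (fun v => g v - g 0 - (fderiv ℝ g 0 v + fderiv ℝ (fderiv ℝ g) 0 v v / 2))
      =o[𝓝 0] (fun v => ‖v‖ ^ 2) := by
  set L := fderiv ℝ g 0
  set B := fderiv ℝ (fderiv ℝ g) 0
  have hd : Differentiable ℝ g := hg.differentiable (by norm_num)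
  have hd' : Differentiable ℝ (fderiv ℝ g) :=
    (hg.fderiv_right (m := 1) (by norm_num)).differentiable (by norm_num)
  have hsymm : ∀ v w, B v w = B w v := fun v w =>
    hg.contDiffAt.isSymmSndFDerivAt (by simp) v w
  have hderiv : ∀ v, HasFDerivAt (fun v => g v - (L v + B v v / 2))
      (fderiv ℝ g v - L - B v) v := by
    intro v
    have h := (hd v).hasFDerivAt.sub (L.hasFDerivAt.add
      ((B.hasFDerivAt (x := v)).clm_apply (hasFDerivAt_id v) |>.mul_const (1 / 2 : ℝ)))
    refine (h.congr_fderiv ?_).congr_of_eventuallyEq (.of_forall fun w => ?_)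
    · ext w
      simp [hsymm w v]
      ring
    · simp
      ring
  have ho : (fun v => fderiv ℝ g v - L - B v) =o[𝓝 0] (fun v => v) := by
    simpa using (hd' 0).hasFDerivAt.isLittleO
  refine isLittleO_iff.2 fun c hc => ?_
  obtain ⟨δ, hδ, hball⟩ := Metric.eventually_nhds_iff_ball.1 (isLittleO_iff.1 ho hc)
  filter_upwards [Metric.ball_mem_nhds (0 : E) hδ] with v hv
  have hsub : ∀ x ∈ Metric.closedBall (0 : E) ‖v‖, ‖fderiv ℝ g x - L - B x‖ ≤ c * ‖v‖ := by
    intro x hx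
    rw [mem_closedBall_zero_iff] at hx
    rw [mem_ball_zero_iff] at hv
    exact (hball x (by simpa using hx.trans_lt hv)).trans (by gcongr)
  have h := (convex_closedBall (0 : E) ‖v‖).norm_image_sub_le_of_norm_hasFDerivWithin_le
    (fun x _ => (hderiv x).hasFDerivWithinAt) hsub (x := 0) (y := v) (by simp) (by simp)
  calc _ = ‖g v - (L v + B v v / 2) - (g 0 - (L 0 + B 0 0 / 2))‖ := by
        congr 1
        simp
        ring
    _ ≤ _ := h
    _ = _ := by
        rw [sub_zero, norm_pow, norm_norm]
        ring

/-- Composition of second-order expansions: the outer function is `x + κ x² / 2 + o(x²)`. -/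
theorem Asymptotics.IsLittleO.comp_taylor_two {α : Type*} {l : Filter α} {φ : ℝ → ℝ} {κ : ℝ}
    (hφ : (fun x => φ x - (x + κ * x ^ 2 / 2)) =o[𝓝 0] (fun x => x ^ 2))
    {y L Q N : α → ℝ} (hN : Tendsto N l (𝓝 0)) (hL : L =O[l] N)
    (hQ : Q =O[l] (fun a => N a ^ 2))
    (hy : (fun a => y a - (L a + Q a / 2)) =o[l] (fun a => N a ^ 2)) :
    (fun a => φ (y a) - (L a + (Q a + κ * L a ^ 2) / 2)) =o[l] (fun a => N a ^ 2) := by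
  have hN1 : N =o[l] (fun _ => (1 : ℝ)) := (isLittleO_one_iff ℝ).2 hN
  have hN2 : (fun a => N a ^ 2) =o[l] N := by
    simpa [sq] using hN1.mul_isBigO (isBigO_refl N l)
  have hyL : (fun a => y a - L a) =O[l] (fun a => N a ^ 2) :=
    (hy.isBigO.add (hQ.const_mul_left (1 / 2))).congr_left fun a => by ring
  have hyN : y =O[l] N :=
    ((hyL.trans hN2.isBigO).add hL).congr_left fun a => by ring
  have hy0 : Tendsto y l (𝓝 0) := hyN.trans_tendsto hN
  have hcomp : (fun a => φ (y a) - (y a + κ * y a ^ 2 / 2)) =o[l] (fun a => N a ^ 2) :=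
    (hφ.comp_tendsto hy0).trans_isBigO (hyN.pow 2)
  have hsq : (fun a => (y a - L a) * (y a + L a)) =o[l] (fun a => N a ^ 2) := by
    simpa using hyL.mul_isLittleO ((hyN.add hL).trans_isLittleO hN1)
  refine ((hcomp.add hy).add (hsq.const_mul_left (κ / 2))).congr_left fun a => ?_
  ring

theorem Real.exp_sub_one_taylor_two :
    (fun x => (Real.exp x - 1) - (x + 1 * x ^ 2 / 2)) =o[𝓝 0] (fun x : ℝ => x ^ 2) := by
  refine (Real.exp_sub_sum_range_succ_isLittleO_pow 2).congr_left fun x => ?_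
  simp [Finset.sum_range_succ]
  ring

theorem Real.log_one_add_taylor_two :
    (fun x => Real.log (1 + x) - (x + (-1) * x ^ 2 / 2)) =o[𝓝 0] (fun x : ℝ => x ^ 2) := by
  refine IsBigO.trans_isLittleO (g := fun x : ℝ => x ^ 3) ?_ (isLittleO_pow_pow (by norm_num))
  refine .of_bound 2 ?_
  filter_upwards [Metric.ball_mem_nhds (0 : ℝ) (show (0 : ℝ) < 1 / 2 by norm_num)] with x hx
  have hx' : |x| < 1 / 2 := by simpa using hx
  have h := Real.abs_log_sub_add_sum_range_le (x := -x) (by rw [abs_neg]; linarith) 2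
  simp only [Finset.sum_range_succ, Finset.sum_range_zero, abs_neg, sub_neg_eq_add] at h
  norm_num at h
  have hb : |x| ^ 3 / (1 - |x|) ≤ 2 * |x| ^ 3 := by
    rw [div_le_iff₀ (by linarith)]
    nlinarith [pow_nonneg (abs_nonneg x) 3]
  rw [Real.norm_eq_abs, norm_pow, Real.norm_eq_abs]
  refine le_trans (le_of_eq ?_) (h.trans hb)
  congr 1
  ring

/-- A pointwise `o(‖v‖²)` bound integrates along a random vector in the unit ball. -/
theorem Asymptotics.IsLittleO.integral_smul {E Ω : Type*} [NormedAddCommGroup E] [NormedSpace ℝ E]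
    [MeasurableSpace Ω] {μ : Measure Ω} [IsProbabilityMeasure μ] {X : Ω → E}
    (hX : ∀ᵐ ω ∂μ, ‖X ω‖ ≤ 1) {R : E → ℝ} (hR : R =o[𝓝 0] (fun v => ‖v‖ ^ 2)) :
    (fun ε : ℝ => ∫ ω, R (ε • X ω) ∂μ) =o[𝓝 0] (fun ε => ε ^ 2) := by
  refine isLittleO_iff.2 fun c hc => ?_
  obtain ⟨δ, hδ, hball⟩ := Metric.eventually_nhds_iff_ball.1 (isLittleO_iff.1 hR hc)
  filter_upwards [Metric.ball_mem_nhds (0 : ℝ) hδ] with ε hε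
  rw [mem_ball_zero_iff] at hε
  have hbound : ∀ᵐ ω ∂μ, ‖R (ε • X ω)‖ ≤ c * ‖ε ^ 2‖ := by
    filter_upwards [hX] with ω hω
    have hle : ‖ε • X ω‖ ≤ ‖ε‖ := by
      rw [norm_smul]
      exact mul_le_of_le_one_right (norm_nonneg _) hω
    refine (hball _ (by simpa using hle.trans_lt hε)).trans ?_
    rw [norm_pow, _root_.norm_norm, norm_pow]
    gcongr
  simpa using norm_integral_le_of_norm_le_const hbound

theorem Continuous.integrable_comp_of_norm_le {E Ω : Type*} [NormedAddCommGroup E] [ProperSpace E]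
    [MeasurableSpace E] [BorelSpace E] [MeasurableSpace Ω] {μ : Measure Ω} [IsFiniteMeasure μ]
    {X : Ω → E} (hXm : Measurable X) {C : ℝ} (hX : ∀ᵐ ω ∂μ, ‖X ω‖ ≤ C)
    {F : E → ℝ} (hF : Continuous F) : Integrable (fun ω => F (X ω)) μ := by
  obtain ⟨M, hM⟩ := (isCompact_closedBall (0 : E) C).exists_bound_of_continuousOn hF.continuousOn
  refine .of_bound (hF.measurable.comp hXm).aestronglyMeasurable M ?_
  filter_upwards [hX] with ω hω
  exact hM _ (by simpa using hω)

/-- Second-order expansion of the logarithm of `E[exp (g (ε • X))]` for a random vector `X` in the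
unit ball and a `C²` function `g`. -/
theorem log_integral_exp_taylor_two {E Ω : Type*} [NormedAddCommGroup E] [NormedSpace ℝ E]
    [ProperSpace E] [MeasurableSpace E] [BorelSpace E] [MeasurableSpace Ω] {μ : Measure Ω}
    [IsProbabilityMeasure μ] {X : Ω → E} (hXm : Measurable X) (hX : ∀ᵐ ω ∂μ, ‖X ω‖ ≤ 1)
    {g : E → ℝ} (hg : ContDiff ℝ 2 g) :
    (fun ε : ℝ => Real.log (∫ ω, Real.exp (g (ε • X ω)) ∂μ)
        - (g 0 + (∫ ω, fderiv ℝ g 0 (X ω) ∂μ) * ε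
          + (1 / 2) * ((∫ ω, fderiv ℝ (fderiv ℝ g) 0 (X ω) (X ω) ∂μ)
            + ((∫ ω, fderiv ℝ g 0 (X ω) ^ 2 ∂μ) - (∫ ω, fderiv ℝ g 0 (X ω) ∂μ) ^ 2)) * ε ^ 2))
      =o[𝓝 0] (fun ε => ε ^ 2) := by
  have htaylor := hg.taylor_two_isLittleO
  have hgc := hg.continuous
  set L := fderiv ℝ g 0
  set B := fderiv ℝ (fderiv ℝ g) 0
  have hexp := Real.exp_sub_one_taylor_two.comp_taylor_two
    (L := fun v => L v) (Q := fun v => B v v) (tendsto_norm_zero (E := E))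
    (L.isBigO_id (𝓝 0)).norm_right
    (.of_bound ‖B‖ (.of_forall fun v => (B.le_opNorm₂ v v).trans
      (le_of_eq (by rw [norm_pow, norm_norm]; ring)))) htaylor
  have hint : ∀ {F : E → ℝ}, Continuous F → Integrable (fun ω => F (X ω)) μ :=
    fun hF => hF.integrable_comp_of_norm_le hXm hX
  have hBint : Integrable (fun ω => B (X ω) (X ω)) μ :=
    hint (F := fun v => B v v) (by fun_prop)
  have hL2int : Integrable (fun ω => L (X ω) ^ 2) μ :=
    hint (F := fun v => L v ^ 2) (by fun_prop)
  have hLint : Integrable (fun ω => L (X ω)) μ := hint (F := fun v => L v) (by fun_prop)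
  have hEint : ∀ ε : ℝ, Integrable (fun ω => Real.exp (g (ε • X ω))) μ := fun ε =>
    hint (F := fun v => Real.exp (g (ε • v))) (by fun_prop)
  set l := ∫ ω, L (X ω) ∂μ
  set b := ∫ ω, B (X ω) (X ω) ∂μ
  set q := ∫ ω, L (X ω) ^ 2 ∂μ
  have hmoment : (fun ε : ℝ => (Real.exp (-g 0) * (∫ ω, Real.exp (g (ε • X ω)) ∂μ) - 1)
      - (l * ε + (b + q) * ε ^ 2 / 2)) =o[𝓝 0] (fun ε => ε ^ 2) := by
    refine (hexp.integral_smul hX).congr_left fun ε => ?_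
    have heq : ∀ ω, Real.exp (g (ε • X ω) - g 0) - 1
          - (L (ε • X ω) + (B (ε • X ω) (ε • X ω) + 1 * L (ε • X ω) ^ 2) / 2)
        = Real.exp (-g 0) * Real.exp (g (ε • X ω)) - 1
          - (L (X ω) * ε + (B (X ω) (X ω) + L (X ω) ^ 2) * (ε ^ 2 / 2)) := by
      intro ω
      rw [sub_eq_neg_add (g _), Real.exp_add]
      simp
      ring
    simp_rw [heq]
    have hE1 : Integrable (fun ω => Real.exp (-g 0) * Real.exp (g (ε • X ω)) - 1) μ :=
      ((hEint ε).const_mul _).sub (integrable_const _)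
    have hQ : Integrable (fun ω => (B (X ω) (X ω) + L (X ω) ^ 2) * (ε ^ 2 / 2)) μ :=
      (hBint.add hL2int).mul_const _
    have hLQ : Integrable (fun ω => L (X ω) * ε
        + (B (X ω) (X ω) + L (X ω) ^ 2) * (ε ^ 2 / 2)) μ := (hLint.mul_const ε).add hQ
    rw [integral_sub hE1 hLQ, integral_sub ((hEint ε).const_mul _) (integrable_const _),
      integral_add (hLint.mul_const _) hQ, integral_const_mul, integral_mul_const,
      integral_mul_const, integral_add hBint hL2int]
    simp
    ring
  have hlog := Real.log_one_add_taylor_two.comp_taylor_two (N := fun ε : ℝ => ε)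
    (L := fun ε => l * ε) (Q := fun ε => (b + q) * ε ^ 2) tendsto_id
    ((isBigO_refl _ _).const_mul_left _) ((isBigO_refl _ _).const_mul_left _) hmoment
  refine hlog.congr_left fun ε => ?_
  rw [add_sub_cancel, Real.log_mul (Real.exp_pos _).ne' (integral_exp_pos (hEint ε)).ne',
    Real.log_exp]
  ring

/-- Second-order Taylor expansion of `ln E[exp (g (ε • η)) | η_t = i]` for a
binary process `η`, `i ∈ {0,1}` with `P(η_t = i) > 0`, and a `C²` function
`g` with gradient `γ` and Hessian `H` at the origin. -/
theorem log_cond_MGF_taylor_binary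
    {T : Type*} [Fintype T] [Nonempty T]
    {Ω : Type*} [MeasurableSpace Ω] (P : Measure Ω) [IsProbabilityMeasure P]
    (η : Ω → T → ℝ) (hη : Measurable η)
    (hbin : ∀ t : T, ∀ᵐ ω ∂P, η ω t = 0 ∨ η ω t = 1)
    (t : T) (i : ℝ) (hi : i = 0 ∨ i = 1)
    (hpos : 0 < P {ω | η ω t = i})
    (g : (T → ℝ) → ℝ) (hg : ContDiff ℝ 2 g)
    (γ : T → ℝ) (hγ : ∀ v : T → ℝ, fderiv ℝ g 0 v = ∑ s, γ s * v s)
    (H : T → T → ℝ)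
    (hH : ∀ v w : T → ℝ,
      fderiv ℝ (fderiv ℝ g) 0 v w = ∑ s, ∑ u, v s * H s u * w u) :
    (fun ε : ℝ =>
        Real.log (∫ ω, Real.exp (g (ε • η ω)) ∂(P[|{ω | η ω t = i}]))
          - (g 0
            + (∑ s, γ s * ∫ ω, η ω s ∂(P[|{ω | η ω t = i}])) * ε
            + (1 / 2) *
              ((∫ ω, ∑ s, ∑ u, η ω s * H s u * η ω u ∂(P[|{ω | η ω t = i}]))
                + ∑ s, ∑ u, γ s *
                    ((∫ ω, η ω s * η ω u ∂(P[|{ω | η ω t = i}]))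
                      - (∫ ω, η ω s ∂(P[|{ω | η ω t = i}]))
                        * (∫ ω, η ω u ∂(P[|{ω | η ω t = i}]))) * γ u)
              * ε ^ 2))
      =o[𝓝 (0 : ℝ)] (fun ε : ℝ => ε ^ 2) := by
  have : IsProbabilityMeasure (P[|{ω | η ω t = i}]) := cond_isProbabilityMeasure hpos.ne'
  have hbin' : ∀ᵐ ω ∂(P[|{ω | η ω t = i}]), ∀ s, η ω s = 0 ∨ η ω s = 1 :=
    cond_absolutelyContinuous.ae_le (ae_all_iff.2 hbin)
  generalize P[|{ω | η ω t = i}] = μ at *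
  have hX : ∀ᵐ ω ∂μ, ‖η ω‖ ≤ 1 := by
    filter_upwards [hbin'] with ω hω
    refine (pi_norm_le_iff_of_nonneg zero_le_one).2 fun s => ?_
    rcases hω s with h | h <;> simp [h]
  have hint : ∀ {F : (T → ℝ) → ℝ}, Continuous F → Integrable (fun ω => F (η ω)) μ :=
    fun hF => hF.integrable_comp_of_norm_le hη hX
  have hmean : ∫ ω, ∑ s, γ s * η ω s ∂μ = ∑ s, γ s * ∫ ω, η ω s ∂μ := by
    rw [integral_finsetSum _ fun s _ => hint (F := fun v => γ s * v s) (by fun_prop)]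
    simp_rw [integral_const_mul]
  have hsq : ∫ ω, (∑ s, γ s * η ω s) ^ 2 ∂μ
      = ∑ s, ∑ u, γ s * (∫ ω, η ω s * η ω u ∂μ) * γ u := by
    have heq : ∀ ω, (∑ s, γ s * η ω s) ^ 2 = ∑ s, ∑ u, γ s * (η ω s * η ω u) * γ u := by
      intro ω
      rw [sq, Finset.sum_mul_sum]
      exact Finset.sum_congr rfl fun s _ => Finset.sum_congr rfl fun u _ => by ring
    simp_rw [heq]
    rw [integral_finsetSum _ fun s _ =>
      hint (F := fun v => ∑ u, γ s * (v s * v u) * γ u) (by fun_prop)]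
    refine Finset.sum_congr rfl fun s _ => ?_
    rw [integral_finsetSum _ fun u _ => hint (F := fun v => γ s * (v s * v u) * γ u) (by fun_prop)]
    simp_rw [integral_mul_const, integral_const_mul]
  have hcov : ∑ s, ∑ u, γ s * ((∫ ω, η ω s * η ω u ∂μ)
        - (∫ ω, η ω s ∂μ) * (∫ ω, η ω u ∂μ)) * γ u
      = (∑ s, ∑ u, γ s * (∫ ω, η ω s * η ω u ∂μ) * γ u)
        - (∑ s, γ s * ∫ ω, η ω s ∂μ) ^ 2 := by
    rw [sq, Finset.sum_mul_sum, ← Finset.sum_sub_distrib]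
    refine Finset.sum_congr rfl fun s _ => ?_
    rw [← Finset.sum_sub_distrib]
    exact Finset.sum_congr rfl fun u _ => by ring
  have hmain := log_integral_exp_taylor_two hη hX hg
  simp only [hγ, hH, hmean, hsq] at hmain
  rw [hcov]
  exact hmain
end

section
/- Let T be a nonempty finite index set, let η : Ω → ℝ^T be a binary process on a probability space (Ω, 𝓕, P), and fix t ∈ T with 0 < P(η_t = 1) < 1. For each s ∈ T let g_s : ℝ → ℝ be twice continuously differentiable, set γ_s = g_s'(0) and k_s = g_s''(0), write γ = (γ_s)_{s∈T} and k = (k_s)_{s∈T}, and define g : ℝ^T → ℝ by g(θ) = Σ_{s∈T} g_s(θ_s). For i ∈ {0,1} let E_{i}[·] and Cov_{i}(·) denote expectation and covariance conditional on {η_t = i}, and for ε ∈ ℝ define r(ε) = ln( P(η_t = 1)/P(η_t = 0) ) + ln E_{1}[exp(g(ε·η))] − ln E_{0}[exp(g(ε·η))]. Then, as ε → 0, r(ε) = ln( P(η_t = 1)/P(η_t = 0) ) + γᵀ( E_{1}[η] − E_{0}[η] ) ε + (1/2) kᵀ( E_{1}[η] − E_{0}[η] ) ε² + (1/2) γᵀ(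 Cov_{1}(η) − Cov_{0}(η) ) γ ε² + o(ε²). -/
open MeasureTheory ProbabilityTheory Asymptotics Filter Topology

/-- Second-order Taylor expansion at `0` of a `C²` function of one real variable. -/
lemma taylor_two_isLittleO {f : ℝ → ℝ} (hf : ContDiff ℝ 2 f) :
    (fun x => f x - f 0 - (deriv f 0 * x + deriv (deriv f) 0 / 2 * x ^ 2))
      =o[𝓝 0] fun x => x ^ 2 := by
  have h := taylor_isLittleO_univ (x₀ := 0) (n := 2) hf
  simp only [sub_zero] at h
  refine h.congr_left fun x => ?_
  simp [taylorWithinEval_succ, iteratedDerivWithin_univ, iteratedDeriv_succ]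
  ring

lemma log_one_add_sub_isLittleO :
    (fun x : ℝ => Real.log (1 + x) - (x - x ^ 2 / 2)) =o[𝓝 0] fun x => x ^ 2 := by
  have hO : (fun x : ℝ => Real.log (1 + x) - (x - x ^ 2 / 2)) =O[𝓝 0] fun x => x ^ 3 := by
    refine IsBigO.of_bound 2 ?_
    filter_upwards [Metric.ball_mem_nhds (0 : ℝ) (by norm_num : (0 : ℝ) < 1 / 2)] with x hx
    have hx' : |x| < 1 / 2 := by simpa using hx
    have h := Real.abs_log_sub_add_sum_range_le (x := -x) (by rw [abs_neg]; linarith) 2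
    rw [abs_neg] at h
    have hden : |x| ^ 3 / (1 - |x|) ≤ 2 * |x| ^ 3 := by
      rw [div_le_iff₀ (by linarith)]
      nlinarith [pow_nonneg (abs_nonneg x) 3]
    simp only [Real.norm_eq_abs, abs_pow]
    refine le_trans (le_of_eq ?_) (h.trans hden)
    congr 1
    norm_num [Finset.sum_range_succ]
    ring
  exact hO.trans_isLittleO (isLittleO_pow_pow (by norm_num))

/-- A function with a second-order expansion without constant term is `O(x)`. -/
lemma isBigO_id_of_quadratic_expansion {f : ℝ → ℝ} {a b : ℝ}
    (hf : (fun x => f x - (a * x + b * x ^ 2)) =o[𝓝 0] fun x => x ^ 2) :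
    f =O[𝓝 0] fun x => x := by
  have hsq : (fun x : ℝ => x ^ 2) =O[𝓝 0] fun x => x := by
    simpa using (isLittleO_pow_pow (𝕜 := ℝ) (by norm_num : 1 < 2)).isBigO
  have hlin := (isBigO_refl (fun x : ℝ => x) (𝓝 0)).const_mul_left a
  simpa using (hf.isBigO.trans hsq).add (hlin.add (hsq.const_mul_left b))

lemma mul_sub_isLittleO_of_quadratic_expansion {f g : ℝ → ℝ} {a b c d : ℝ}
    (hf : (fun x => f x - (a * x + b * x ^ 2)) =o[𝓝 0] fun x => x ^ 2)
    (hg : (fun x => g x - (c * x + d * x ^ 2)) =o[𝓝 0] fun x => x ^ 2) :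
    (fun x => f x * g x - a * c * x ^ 2) =o[𝓝 0] fun x => x ^ 2 := by
  have hsq : (fun x : ℝ => x ^ 2) =o[𝓝 0] fun x => x := by
    simpa using isLittleO_pow_pow (𝕜 := ℝ) (by norm_num : 1 < 2)
  have hlin : ∀ {u : ℝ → ℝ} {p q : ℝ},
      (fun x => u x - (p * x + q * x ^ 2)) =o[𝓝 0] (fun x => x ^ 2) →
      (fun x => u x - p * x) =o[𝓝 0] fun x => x := fun {u p q} hu =>
    ((hu.trans hsq).add (hsq.const_mul_left q)).congr_left fun x => by ring
  have h₁ := (hlin hf).mul_isBigO (isBigO_id_of_quadratic_expansion hg)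
  have h₂ := ((isBigO_refl (fun x : ℝ => x) (𝓝 0)).const_mul_left a).mul_isLittleO (hlin hg)
  exact (h₁.add h₂).congr (fun x => by ring) fun x => by ring

lemma log_one_add_quadratic_expansion {f : ℝ → ℝ} {a b : ℝ}
    (hf : (fun x => f x - (a * x + b * x ^ 2)) =o[𝓝 0] fun x => x ^ 2) :
    (fun x => Real.log (1 + f x) - (a * x + (b - a ^ 2 / 2) * x ^ 2))
      =o[𝓝 0] fun x => x ^ 2 := by
  have hO := isBigO_id_of_quadratic_expansion hf
  have h₁ := (log_one_add_sub_isLittleO.comp_tendsto (hO.trans_tendsto tendsto_id)).trans_isBigO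
    (hO.pow 2)
  have h₂ := (mul_sub_isLittleO_of_quadratic_expansion hf hf).const_mul_left (1 / 2)
  exact ((h₁.add hf).sub h₂).congr_left fun x => by
    simp only [Function.comp_apply]
    ring

lemma integrable_of_ae_abs_le {Ω : Type*} [MeasurableSpace Ω] {μ : Measure Ω}
    [IsFiniteMeasure μ] {X : Ω → ℝ} (hX : Measurable X) {C : ℝ} (hC : ∀ᵐ ω ∂μ, |X ω| ≤ C) :
    Integrable X μ :=
  Integrable.of_bound hX.aestronglyMeasurable C hC

section BinaryProcess

variable {T : Type*} [Fintype T] {Ω : Type*} [MeasurableSpace Ω] {μ : Measure Ω}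
  [IsProbabilityMeasure μ] {η : Ω → T → ℝ}

/-- The exponential moment of a linear combination of binary variables whose coefficients are
`O(x)` agrees with its second-order expansion up to `O(x³)`. -/
lemma integral_exp_sum_sub_isLittleO (hη : Measurable η)
    (hbin : ∀ t : T, ∀ᵐ ω ∂μ, η ω t = 0 ∨ η ω t = 1) {h : T → ℝ → ℝ}
    (hh : ∀ s, h s =O[𝓝 0] fun x => x) :
    (fun x => (∫ ω, Real.exp (∑ s, η ω s * h s x) ∂μ) - 1
        - ((∑ s, (∫ ω, η ω s ∂μ) * h s x)
          + 1 / 2 * ∑ s, ∑ u, (∫ ω, η ω s * η ω u ∂μ) * (h s x * h u x)))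
      =o[𝓝 0] fun x => x ^ 2 := by
  have hmeas : ∀ s, Measurable fun ω => η ω s := fun s => (measurable_pi_apply s).comp hη
  have habs : ∀ s, ∀ᵐ ω ∂μ, |η ω s| ≤ 1 := fun s => by
    filter_upwards [hbin s] with ω hω
    rcases hω with hω | hω <;> simp [hω]
  have hint : ∀ s, Integrable (fun ω => η ω s) μ := fun s =>
    integrable_of_ae_abs_le (hmeas s) (habs s)
  have hint₂ : ∀ s u, Integrable (fun ω => η ω s * η ω u) μ := fun s u => by
    refine integrable_of_ae_abs_le ((hmeas s).mul (hmeas u)) (C := 1) ?_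
    filter_upwards [habs s, habs u] with ω hs hu
    rw [abs_mul]
    exact mul_le_one₀ hs (abs_nonneg _) hu
  set H : ℝ → ℝ := fun x => ∑ s, |h s x|
  have hH : H =O[𝓝 0] fun x => x := IsBigO.fun_sum fun s _ => (hh s).abs_left
  have hbound : ∀ x, ∀ᵐ ω ∂μ, |∑ s, η ω s * h s x| ≤ H x := fun x => by
    filter_upwards [ae_all_iff.2 habs] with ω hω
    refine (Finset.abs_sum_le_sum_abs _ _).trans (Finset.sum_le_sum fun s _ => ?_)
    rw [abs_mul]
    exact mul_le_of_le_one_left (abs_nonneg _) (hω s)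
  have hexp : ∀ x, Integrable (fun ω => Real.exp (∑ s, η ω s * h s x)) μ := fun x => by
    refine integrable_of_ae_abs_le (C := Real.exp (H x)) ?_ ?_
    · exact (Finset.measurable_fun_sum _ fun s _ => (hmeas s).mul_const _).exp
    · filter_upwards [hbound x] with ω hω
      rw [Real.abs_exp]
      exact Real.exp_le_exp.2 ((le_abs_self _).trans hω)
  have hrem : ∀ x, (∫ ω, Real.exp (∑ s, η ω s * h s x) ∂μ) - 1
        - ((∑ s, (∫ ω, η ω s ∂μ) * h s x)
          + 1 / 2 * ∑ s, ∑ u, (∫ ω, η ω s * η ω u ∂μ) * (h s x * h u x))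
      = ∫ ω, (Real.exp (∑ s, η ω s * h s x) - 1 - ((∑ s, η ω s * h s x)
          + 1 / 2 * (∑ s, η ω s * h s x) ^ 2)) ∂μ := fun x => by
    have hsq : ∀ ω, (∑ s, η ω s * h s x) ^ 2
        = ∑ s, ∑ u, η ω s * η ω u * (h s x * h u x) := fun ω => by
      rw [sq, Finset.sum_mul_sum]
      exact Finset.sum_congr rfl fun s _ => Finset.sum_congr rfl fun u _ => by ring
    have hi₁ : Integrable (fun ω => ∑ s, η ω s * h s x) μ :=
      integrable_finsetSum _ fun s _ => (hint s).mul_const _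
    have hi₂ : Integrable (fun ω => ∑ s, ∑ u, η ω s * η ω u * (h s x * h u x)) μ :=
      integrable_finsetSum _ fun s _ => integrable_finsetSum _ fun u _ =>
        (hint₂ s u).mul_const _
    have hi₃ : Integrable (fun ω => Real.exp (∑ s, η ω s * h s x) - 1) μ :=
      (hexp x).sub (integrable_const _)
    have hi₄ : Integrable (fun ω => (∑ s, η ω s * h s x)
        + 1 / 2 * ∑ s, ∑ u, η ω s * η ω u * (h s x * h u x)) μ := hi₁.add (hi₂.const_mul _)
    simp_rw [hsq]
    rw [integral_sub hi₃ hi₄,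
      integral_sub (hexp x) (integrable_const _), integral_add hi₁ (hi₂.const_mul _),
      integral_const_mul, integral_finsetSum _ fun s _ => (hint s).mul_const _,
      integral_finsetSum _ fun s _ => integrable_finsetSum _ fun u _ =>
        (hint₂ s u).mul_const _]
    simp_rw [integral_finsetSum _ fun u _ => (hint₂ _ u).mul_const _, integral_mul_const]
    simp
  have hO : (fun x => ∫ ω, (Real.exp (∑ s, η ω s * h s x) - 1 - ((∑ s, η ω s * h s x)
      + 1 / 2 * (∑ s, η ω s * h s x) ^ 2)) ∂μ) =O[𝓝 0] fun x => H x ^ 3 := by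
    refine IsBigO.of_bound 1 ?_
    have hsmall : ∀ᶠ x in 𝓝 0, H x < 1 :=
      (hH.trans_tendsto tendsto_id).eventually_lt_const one_pos
    filter_upwards [hsmall] with x hx
    have hH0 : 0 ≤ H x := Finset.sum_nonneg fun s _ => abs_nonneg _
    refine (norm_integral_le_of_norm_le_const (C := H x ^ 3) ?_).trans ?_
    · filter_upwards [hbound x] with ω hω
      have hb := Real.exp_bound (hω.trans hx.le) (n := 3) (by norm_num)
      refine le_trans (le_of_eq ?_) (hb.trans ?_)
      · rw [Real.norm_eq_abs]
        congr 1
        norm_num [Finset.sum_range_succ, Nat.factorial]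
        ring
      · refine (mul_le_of_le_one_right (by positivity) ?_).trans
          (pow_le_pow_left₀ (abs_nonneg _) hω 3)
        norm_num [Nat.factorial]
    · simp [abs_of_nonneg hH0]
  exact ((hO.trans (hH.pow 3)).trans_isLittleO (isLittleO_pow_pow (by norm_num))).congr_left
    fun x => (hrem x).symm

/-- Second-order expansion of `log E[exp (∑ s, gₛ (x ηₛ))]` for a binary process `η`. -/
lemma log_integral_exp_quadratic_expansion (hη : Measurable η)
    (hbin : ∀ t : T, ∀ᵐ ω ∂μ, η ω t = 0 ∨ η ω t = 1) {gs : T → ℝ → ℝ}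
    (hgs : ∀ s, ContDiff ℝ 2 (gs s)) {γ k : T → ℝ} (hγ : ∀ s, γ s = deriv (gs s) 0)
    (hk : ∀ s, k s = deriv (deriv (gs s)) 0) :
    (fun x => Real.log (∫ ω, Real.exp (∑ s, gs s (x * η ω s)) ∂μ)
        - (∑ s, gs s 0 + (∑ s, γ s * ∫ ω, η ω s ∂μ) * x
          + 1 / 2 * (∑ s, k s * ∫ ω, η ω s ∂μ) * x ^ 2
          + 1 / 2 * (∑ s, ∑ u, γ s * ((∫ ω, η ω s * η ω u ∂μ)
              - (∫ ω, η ω s ∂μ) * ∫ ω, η ω u ∂μ) * γ u) * x ^ 2))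
      =o[𝓝 0] fun x => x ^ 2 := by
  set h : T → ℝ → ℝ := fun s x => gs s x - gs s 0 with hdef
  have hexp : ∀ s, (fun x => h s x - (γ s * x + k s / 2 * x ^ 2)) =o[𝓝 0] fun x => x ^ 2 :=
    fun s => by
      rw [hγ, hk]
      exact taylor_two_isLittleO (hgs s)
  set a : ℝ := ∑ s, γ s * ∫ ω, η ω s ∂μ with ha
  set M : ℝ → ℝ := fun x => (∫ ω, Real.exp (∑ s, η ω s * h s x) ∂μ) - 1 with hM
  have hMexp : (fun x => M x - (a * x + (1 / 2 * (∑ s, k s * ∫ ω, η ω s ∂μ)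
      + 1 / 2 * ∑ s, ∑ u, γ s * (∫ ω, η ω s * η ω u ∂μ) * γ u) * x ^ 2))
      =o[𝓝 0] fun x => x ^ 2 := by
    have h₀ := integral_exp_sum_sub_isLittleO hη hbin
      fun s => isBigO_id_of_quadratic_expansion (hexp s)
    have h₁ : (fun x => ∑ s, (∫ ω, η ω s ∂μ) * (h s x - (γ s * x + k s / 2 * x ^ 2)))
        =o[𝓝 0] fun x => x ^ 2 := IsLittleO.fun_sum fun s _ => (hexp s).const_mul_left _
    have h₂ : (fun x => ∑ s, ∑ u, (∫ ω, η ω s * η ω u ∂μ) * (h s x * h u x - γ s * γ u * x ^ 2))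
        =o[𝓝 0] fun x => x ^ 2 := IsLittleO.fun_sum fun s _ => IsLittleO.fun_sum fun u _ =>
      (mul_sub_isLittleO_of_quadratic_expansion (hexp s) (hexp u)).const_mul_left _
    refine ((h₀.add h₁).add (h₂.const_mul_left (1 / 2))).congr_left fun x => ?_
    have e₁ : ∑ s, (∫ ω, η ω s ∂μ) * (h s x - (γ s * x + k s / 2 * x ^ 2))
        = ∑ s, (∫ ω, η ω s ∂μ) * h s x
          - (a * x + 1 / 2 * (∑ s, k s * ∫ ω, η ω s ∂μ) * x ^ 2) := by
      rw [ha, Finset.sum_mul, Finset.mul_sum, Finset.sum_mul, ← Finset.sum_add_distrib,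
        ← Finset.sum_sub_distrib]
      exact Finset.sum_congr rfl fun s _ => by ring
    have e₂ : ∑ s, ∑ u, (∫ ω, η ω s * η ω u ∂μ) * (h s x * h u x - γ s * γ u * x ^ 2)
        = ∑ s, ∑ u, (∫ ω, η ω s * η ω u ∂μ) * (h s x * h u x)
          - (∑ s, ∑ u, γ s * (∫ ω, η ω s * η ω u ∂μ) * γ u) * x ^ 2 := by
      simp_rw [Finset.sum_mul, ← Finset.sum_sub_distrib]
      exact Finset.sum_congr rfl fun s _ => Finset.sum_congr rfl fun u _ => by ring
    rw [e₁, e₂]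
    ring
  have hcov : ∑ s, ∑ u, γ s * ((∫ ω, η ω s * η ω u ∂μ)
        - (∫ ω, η ω s ∂μ) * ∫ ω, η ω u ∂μ) * γ u
      = (∑ s, ∑ u, γ s * (∫ ω, η ω s * η ω u ∂μ) * γ u) - a ^ 2 := by
    rw [ha, sq, Finset.sum_mul_sum]
    simp_rw [← Finset.sum_sub_distrib]
    exact Finset.sum_congr rfl fun s _ => Finset.sum_congr rfl fun u _ => by ring
  refine (log_one_add_quadratic_expansion hMexp).congr_left fun x => ?_
  have hfac : ∫ ω, Real.exp (∑ s, gs s (x * η ω s)) ∂μ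
      = Real.exp (∑ s, gs s 0) * ∫ ω, Real.exp (∑ s, η ω s * h s x) ∂μ := by
    rw [← integral_const_mul]
    refine integral_congr_ae ?_
    filter_upwards [ae_all_iff.2 hbin] with ω hω
    rw [← Real.exp_add, ← Finset.sum_add_distrib]
    congr 1
    refine Finset.sum_congr rfl fun s _ => ?_
    rcases hω s with hs | hs <;> simp [hs, hdef]
  have hpos : 0 < ∫ ω, Real.exp (∑ s, η ω s * h s x) ∂μ := by
    refine integral_exp_pos ?_
    have hmeas : ∀ s, Measurable fun ω => η ω s := fun s => (measurable_pi_apply s).comp hη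
    refine integrable_of_ae_abs_le (C := Real.exp (∑ s, |h s x|))
      (Finset.measurable_fun_sum _ fun s _ => (hmeas s).mul_const _).exp ?_
    filter_upwards [ae_all_iff.2 hbin] with ω hω
    rw [Real.abs_exp, Real.exp_le_exp]
    refine Finset.sum_le_sum fun s _ => ?_
    rcases hω s with hs | hs <;> simp [hs, le_abs_self]
  rw [hfac, Real.log_mul (Real.exp_pos _).ne' hpos.ne', Real.log_exp, hcov, hM]
  simp only [add_sub_cancel]
  ring

end BinaryProcess

/-- Corollary 1 (eq. (8), "PL-R-localized"): with the localized form
`g θ = ∑ s, gₛ (θ s)`, the conditional log-likelihood ratio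
`r(ε) = ln(P(η_t=1)/P(η_t=0)) + ln E₁[exp (g (ε • η))] − ln E₀[exp (g (ε • η))]`
admits the expansion with first derivatives `γ s = gₛ'(0)` and second
derivatives `k s = gₛ''(0)`. -/
theorem cond_loglik_ratio_taylor_localized
    {T : Type*} [Fintype T] [Nonempty T]
    {Ω : Type*} [MeasurableSpace Ω] (P : Measure Ω) [IsProbabilityMeasure P]
    (η : Ω → T → ℝ) (hη : Measurable η)
    (hbin : ∀ t : T, ∀ᵐ ω ∂P, η ω t = 0 ∨ η ω t = 1)
    (t : T) (h0 : 0 < P {ω | η ω t = 1}) (h1 : P {ω | η ω t = 1} < 1)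
    (gs : T → ℝ → ℝ) (hgs : ∀ s : T, ContDiff ℝ 2 (gs s))
    (γ k : T → ℝ)
    (hγ : ∀ s : T, γ s = deriv (gs s) 0)
    (hk : ∀ s : T, k s = deriv (deriv (gs s)) 0)
    (g : (T → ℝ) → ℝ) (hg : ∀ θ : T → ℝ, g θ = ∑ s, gs s (θ s)) :
    (fun ε : ℝ =>
        (Real.log ((P {ω | η ω t = 1}).toReal / (P {ω | η ω t = 0}).toReal)
          + Real.log (∫ ω, Real.exp (g (ε • η ω)) ∂(P[|{ω | η ω t = 1}]))
          - Real.log (∫ ω, Real.exp (g (ε • η ω)) ∂(P[|{ω | η ω t = 0}])))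
        - (Real.log ((P {ω | η ω t = 1}).toReal / (P {ω | η ω t = 0}).toReal)
          + (∑ s, γ s * ((∫ ω, η ω s ∂(P[|{ω | η ω t = 1}]))
              - (∫ ω, η ω s ∂(P[|{ω | η ω t = 0}])))) * ε
          + (1 / 2) *
              (∑ s, k s * ((∫ ω, η ω s ∂(P[|{ω | η ω t = 1}]))
                - (∫ ω, η ω s ∂(P[|{ω | η ω t = 0}])))) * ε ^ 2
          + (1 / 2) *
              (∑ s, ∑ u, γ s *
                (((∫ ω, η ω s * η ω u ∂(P[|{ω | η ω t = 1}]))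
                    - (∫ ω, η ω s ∂(P[|{ω | η ω t = 1}]))
                      * (∫ ω, η ω u ∂(P[|{ω | η ω t = 1}])))
                  - ((∫ ω, η ω s * η ω u ∂(P[|{ω | η ω t = 0}]))
                    - (∫ ω, η ω s ∂(P[|{ω | η ω t = 0}]))
                      * (∫ ω, η ω u ∂(P[|{ω | η ω t = 0}])))) * γ u)
              * ε ^ 2))
      =o[𝓝 (0 : ℝ)] (fun ε : ℝ => ε ^ 2) := by
  have hP1 : P {ω | η ω t = 1} ≠ 0 := h0.ne'
  have hP0 : P {ω | η ω t = 0} ≠ 0 := fun hz => by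
    refine h1.ne (prob_compl_eq_zero_iff ?_ |>.1 ?_)
    · exact (measurable_pi_apply t).comp hη (measurableSet_singleton 1)
    · have hnot : ∀ᵐ ω ∂P, ω ∉ {ω | η ω t = 0} := measure_eq_zero_iff_ae_notMem.1 hz
      refine measure_eq_zero_iff_ae_notMem.2 ?_
      filter_upwards [hnot, hbin t] with ω hω hω2
      simpa using hω2.resolve_left hω
  have := cond_isProbabilityMeasure hP1
  have := cond_isProbabilityMeasure hP0
  have hbin' : ∀ A : Set Ω, ∀ s, ∀ᵐ ω ∂(P[|A]), η ω s = 0 ∨ η ω s = 1 := fun A s =>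
    cond_absolutelyContinuous.ae_le (hbin s)
  have e₁ := log_integral_exp_quadratic_expansion hη (hbin' {ω | η ω t = 1}) hgs hγ hk
  have e₀ := log_integral_exp_quadratic_expansion hη (hbin' {ω | η ω t = 0}) hgs hγ hk
  refine (e₁.sub e₀).congr_left fun ε => ?_
  simp only [hg, Pi.smul_apply, smul_eq_mul, mul_sub, sub_mul, Finset.sum_sub_distrib]
  ring
end

section
/- Let T be a nonempty finite index set, let η : Ω → ℝ^T be a binary process on a probability space (Ω, 𝓕, P), and fix t ∈ T with 0 < P(η_t = 1) < 1. Let h : ℝ → ℝ be twice continuously differentiable, fix x = (x_s)_{s∈T} ∈ ℝ^T, and define g : ℝ^T → ℝ by g(u) = Σ_{s∈T} ( u_s + h(x_s e^{u_s}) ) (the log conditional density of multiplicative-noise data x given signal u). Define vectors G(x) = (1 + x_s h'(x_s))_{s∈T} and U(x) = (x_s h'(x_s) + x_s² h''(x_s))_{s∈T}. For i ∈ {0,1} let E_{i}[·] and Cov_{i}(·) denote expectation and covariance conditional on {η_t = i}, and for ε ∈ ℝ define r(ε) = ln( P(η_t = 1)/P(η_t = 0) ) + ln E_{1}[exp(g(ε·η))]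 − ln E_{0}[exp(g(ε·η))]. Then, as ε → 0, r(ε) = ln( P(η_t = 1)/P(η_t = 0) ) + G(x)ᵀ( E_{1}[η] − E_{0}[η] ) ε + (1/2) G(x)ᵀ( Cov_{1}(η) − Cov_{0}(η) ) G(x) ε² + (1/2) U(x)ᵀ( E_{1}[η] − E_{0}[η] ) ε² + o(ε²). -/
open MeasureTheory ProbabilityTheory Asymptotics Filter Topology

/-- Second-order Taylor expansion at the origin in little-o form. -/
lemma ContDiff.isLittleO_taylor_two {f : ℝ → ℝ} (hf : ContDiff ℝ 2 f) :
    (fun ε : ℝ => f ε - (f 0 + deriv f 0 * ε + deriv (deriv f) 0 / 2 * ε ^ 2))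
      =o[𝓝 0] fun ε => ε ^ 2 := by
  have key := taylor_isLittleO_univ (x₀ := 0) (n := 2) (f := f) (by exact_mod_cast hf)
  simp only [sub_zero] at key
  refine key.congr_left fun ε => ?_
  rw [taylorWithinEval_succ, taylorWithinEval_succ, taylor_within_zero_eval]
  simp only [iteratedDerivWithin_univ, iteratedDeriv_succ, iteratedDeriv_zero, smul_eq_mul,
    Nat.factorial]
  norm_num
  ring

lemma isLittleO_linear_of_quadratic {a : ℝ → ℝ} {c d : ℝ}
    (ha : (fun ε => a ε - (c * ε + d * ε ^ 2)) =o[𝓝 0] fun ε : ℝ => ε ^ 2) :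
    (fun ε => a ε - c * ε) =o[𝓝 0] fun ε : ℝ => ε := by
  have hsq : (fun ε : ℝ => ε ^ 2) =o[𝓝 0] fun ε : ℝ => ε := by
    simpa using isLittleO_pow_pow (𝕜 := ℝ) (m := 1) (n := 2) (by norm_num)
  exact ((ha.trans hsq).add (hsq.const_mul_left d)).congr_left fun ε => by ring

lemma isBigO_id_of_isLittleO_linear {a : ℝ → ℝ} {c : ℝ}
    (ha : (fun ε => a ε - c * ε) =o[𝓝 0] fun ε : ℝ => ε) :
    a =O[𝓝 0] fun ε : ℝ => ε :=
  (ha.isBigO.add ((isBigO_refl (fun ε : ℝ => ε) _).const_mul_left c)).congr_left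
    fun ε => by ring

/-- The product of two first-order expansions without constant term. -/
lemma isLittleO_mul_sub_sq {a b : ℝ → ℝ} {c d : ℝ}
    (ha : (fun ε => a ε - c * ε) =o[𝓝 0] fun ε : ℝ => ε)
    (hb : (fun ε => b ε - d * ε) =o[𝓝 0] fun ε : ℝ => ε) :
    (fun ε => a ε * b ε - c * d * ε ^ 2) =o[𝓝 0] fun ε : ℝ => ε ^ 2 := by
  have h₁ := ha.mul_isBigO (isBigO_id_of_isLittleO_linear hb)
  have h₂ := ((isBigO_refl (fun ε : ℝ => ε) (𝓝 0)).const_mul_left c).mul_isLittleO hb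
  exact (h₁.add h₂).congr (fun ε => by ring) (fun ε => by ring)

lemma isBigO_log_one_add_sub :
    (fun y : ℝ => Real.log (1 + y) - (y - y ^ 2 / 2)) =O[𝓝 0] fun y => y ^ 3 := by
  refine IsBigO.of_bound 2 ?_
  filter_upwards [Metric.ball_mem_nhds (0 : ℝ) (by norm_num : (0 : ℝ) < 1 / 2)] with y hy
  rw [mem_ball_zero_iff, Real.norm_eq_abs] at hy
  have key := Real.abs_log_sub_add_sum_range_le (x := -y) (by rw [abs_neg]; linarith) 2
  simp only [Finset.sum_range_succ, Finset.sum_range_zero, abs_neg, sub_neg_eq_add] at key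
  norm_num at key
  rw [Real.norm_eq_abs, Real.norm_eq_abs, abs_pow]
  calc |Real.log (1 + y) - (y - y ^ 2 / 2)|
      = |-y + y ^ 2 / 2 + Real.log (1 + y)| := by congr 1; ring
    _ ≤ |y| ^ 3 / (1 - |y|) := key
    _ ≤ 2 * |y| ^ 3 := by
        rw [div_le_iff₀ (by linarith)]
        nlinarith [pow_nonneg (abs_nonneg y) 3]

/-- Second-order expansion of `log (1 + y)` along a second-order expansion of `y`. -/
lemma isLittleO_log_one_add {y : ℝ → ℝ} {m q : ℝ}
    (hy : (fun ε => y ε - (m * ε + q * ε ^ 2)) =o[𝓝 0] fun ε : ℝ => ε ^ 2) :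
    (fun ε => Real.log (1 + y ε) - (m * ε + (q - m ^ 2 / 2) * ε ^ 2))
      =o[𝓝 0] fun ε : ℝ => ε ^ 2 := by
  have hlin := isLittleO_linear_of_quadratic hy
  have hO := isBigO_id_of_isLittleO_linear hlin
  have h0 : Tendsto y (𝓝 0) (𝓝 0) := hO.trans_tendsto tendsto_id
  have hcube : (fun ε : ℝ => ε ^ 3) =o[𝓝 0] fun ε : ℝ => ε ^ 2 :=
    isLittleO_pow_pow (by norm_num)
  have hlog := ((isBigO_log_one_add_sub.comp_tendsto h0).trans (hO.pow 3)).trans_isLittleO hcube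
  have hsq := (isLittleO_mul_sub_sq hlin hlin).const_mul_left (1 / 2)
  exact ((hlog.add hy).sub hsq).congr_left fun ε => by simp only [Function.comp_apply]; ring

/-- The increment of the log density of one coordinate under a unit multiplicative noise. -/
lemma isLittleO_multiplicative_noise_increment {h : ℝ → ℝ} (hh : ContDiff ℝ 2 h) (x : ℝ) :
    (fun ε => (ε + h (x * Real.exp ε) - h x)
      - ((1 + x * deriv h x) * ε
        + (x * deriv h x + x ^ 2 * deriv (deriv h) x) / 2 * ε ^ 2))
      =o[𝓝 0] fun ε : ℝ => ε ^ 2 := by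
  have hcomp : ContDiff ℝ 2 fun ε => h (x * Real.exp ε) :=
    hh.comp (contDiff_const.mul Real.contDiff_exp)
  have hinner (ε : ℝ) : HasDerivAt (fun ε => x * Real.exp ε) (x * Real.exp ε) ε :=
    (Real.hasDerivAt_exp ε).const_mul x
  have hd₁ : deriv (fun ε => h (x * Real.exp ε)) =
      fun ε => deriv h (x * Real.exp ε) * (x * Real.exp ε) := by
    funext ε
    exact ((hh.differentiable (by norm_num) _).hasDerivAt.comp ε (hinner ε)).deriv
  have hdiff : Differentiable ℝ (deriv h) :=
    (hh.iterate_deriv' 1 1).differentiable (by norm_num)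
  have hd₂ : deriv (deriv fun ε => h (x * Real.exp ε)) 0 =
      x * deriv h x + x ^ 2 * deriv (deriv h) x := by
    rw [hd₁]
    have := (((hdiff _).hasDerivAt.comp 0 (hinner 0)).mul (hinner 0)).deriv
    simp only [Real.exp_zero, mul_one, Function.comp_apply] at this
    exact this.trans (by ring)
  refine hcomp.isLittleO_taylor_two.congr_left fun ε => ?_
  rw [hd₂, hd₁]
  simp only [Real.exp_zero, mul_one]
  ring

section BinaryVector

variable {T Ω : Type*} [Fintype T] [MeasurableSpace Ω] {Q : Measure Ω} {ξ : Ω → T → ℝ}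

lemma ae_abs_le_one_of_binary (hbin : ∀ s, ∀ᵐ ω ∂Q, ξ ω s = 0 ∨ ξ ω s = 1) :
    ∀ᵐ ω ∂Q, ∀ s, |ξ ω s| ≤ 1 := by
  filter_upwards [ae_all_iff.2 hbin] with ω hω s
  rcases hω s with h | h <;> simp [h]

lemma ae_abs_sum_mul_le_of_binary (hbin : ∀ s, ∀ᵐ ω ∂Q, ξ ω s = 0 ∨ ξ ω s = 1) (a : T → ℝ) :
    ∀ᵐ ω ∂Q, |∑ s, ξ ω s * a s| ≤ ∑ s, |a s| := by
  filter_upwards [ae_abs_le_one_of_binary hbin] with ω hω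
  refine (Finset.abs_sum_le_sum_abs _ _).trans (Finset.sum_le_sum fun s _ => ?_)
  rw [abs_mul]
  exact mul_le_of_le_one_left (abs_nonneg _) (hω s)

variable [IsProbabilityMeasure Q]

lemma integrable_exp_of_binary (hξ : Measurable ξ)
    (hbin : ∀ s, ∀ᵐ ω ∂Q, ξ ω s = 0 ∨ ξ ω s = 1) (a : T → ℝ) :
    Integrable (fun ω => Real.exp (∑ s, ξ ω s * a s)) Q := by
  have hmeas : Measurable fun ω => ∑ s, ξ ω s * a s :=
    Finset.measurable_sum _ fun s _ => (measurable_pi_iff.1 hξ s).mul_const _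
  refine Integrable.of_bound hmeas.exp.aestronglyMeasurable (Real.exp (∑ s, |a s|))
    ((ae_abs_sum_mul_le_of_binary hbin a).mono fun ω hω => ?_)
  rw [Real.norm_eq_abs, Real.abs_exp]
  exact Real.exp_le_exp.2 ((le_abs_self _).trans hω)

lemma integrable_coord_of_binary (hξ : Measurable ξ)
    (hbin : ∀ s, ∀ᵐ ω ∂Q, ξ ω s = 0 ∨ ξ ω s = 1) (s : T) :
    Integrable (fun ω => ξ ω s) Q :=
  Integrable.of_bound (measurable_pi_iff.1 hξ s).aestronglyMeasurable 1
    ((ae_abs_le_one_of_binary hbin).mono fun _ hω => hω s)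

lemma integrable_coord_mul_of_binary (hξ : Measurable ξ)
    (hbin : ∀ s, ∀ᵐ ω ∂Q, ξ ω s = 0 ∨ ξ ω s = 1) (s u : T) :
    Integrable (fun ω => ξ ω s * ξ ω u) Q := by
  refine Integrable.of_bound
    ((measurable_pi_iff.1 hξ s).mul (measurable_pi_iff.1 hξ u)).aestronglyMeasurable 1
    ((ae_abs_le_one_of_binary hbin).mono fun ω hω => ?_)
  rw [Real.norm_eq_abs, abs_mul]
  exact mul_le_one₀ (hω s) (abs_nonneg _) (hω u)

/-- The exponential moment at `a` agrees with its second-order moment expansion up to a cubic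
error. -/
lemma abs_integral_exp_sub_le (hξ : Measurable ξ)
    (hbin : ∀ s, ∀ᵐ ω ∂Q, ξ ω s = 0 ∨ ξ ω s = 1) (a : T → ℝ) (ha : ∑ s, |a s| ≤ 1) :
    |∫ ω, Real.exp (∑ s, ξ ω s * a s) ∂Q
      - (1 + ∑ s, a s * ∫ ω, ξ ω s ∂Q
        + 1 / 2 * ∑ s, ∑ u, a s * a u * ∫ ω, ξ ω s * ξ ω u ∂Q)| ≤ (∑ s, |a s|) ^ 3 := by
  set S : Ω → ℝ := fun ω => ∑ s, ξ ω s * a s with hS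
  have hSle : ∀ᵐ ω ∂Q, |S ω| ≤ ∑ s, |a s| := ae_abs_sum_mul_le_of_binary hbin a
  have hexp : Integrable (fun ω => Real.exp (S ω)) Q := integrable_exp_of_binary hξ hbin a
  have hi : ∀ s ∈ Finset.univ, Integrable (fun ω => ξ ω s * a s) Q := fun s _ =>
    (integrable_coord_of_binary hξ hbin s).mul_const _
  have hSi : Integrable S Q := integrable_finsetSum _ hi
  have hSint : ∫ ω, S ω ∂Q = ∑ s, a s * ∫ ω, ξ ω s ∂Q := by
    rw [integral_finsetSum _ hi]
    exact Finset.sum_congr rfl fun s _ => by rw [integral_mul_const, mul_comm]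
  have hsq : ∀ ω, S ω ^ 2 = ∑ s, ∑ u, a s * a u * (ξ ω s * ξ ω u) := fun ω => by
    rw [hS, sq, Finset.sum_mul_sum]
    exact Finset.sum_congr rfl fun s _ => Finset.sum_congr rfl fun u _ => by ring
  have hi₂ : ∀ s u, Integrable (fun ω => a s * a u * (ξ ω s * ξ ω u)) Q := fun s u =>
    (integrable_coord_mul_of_binary hξ hbin s u).const_mul _
  have hi₁ : ∀ s, Integrable (fun ω => ∑ u, a s * a u * (ξ ω s * ξ ω u)) Q := fun s =>
    integrable_finsetSum _ fun u _ => hi₂ s u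
  have hsqi : Integrable (fun ω => S ω ^ 2) Q := by
    simp_rw [hsq]
    exact integrable_finsetSum _ fun s _ => hi₁ s
  have hsqint : ∫ ω, S ω ^ 2 ∂Q = ∑ s, ∑ u, a s * a u * ∫ ω, ξ ω s * ξ ω u ∂Q := by
    simp_rw [hsq]
    rw [integral_finsetSum _ fun s _ => hi₁ s]
    refine Finset.sum_congr rfl fun s _ => ?_
    rw [integral_finsetSum _ fun u _ => hi₂ s u]
    exact Finset.sum_congr rfl fun u _ => integral_const_mul _ _
  have hpoly : Integrable (fun ω => 1 + S ω + 1 / 2 * S ω ^ 2) Q :=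
    ((integrable_const _).add hSi).add (hsqi.const_mul _)
  have hpolyint : ∫ ω, (1 + S ω + 1 / 2 * S ω ^ 2) ∂Q =
      1 + ∑ s, a s * ∫ ω, ξ ω s ∂Q
        + 1 / 2 * ∑ s, ∑ u, a s * a u * ∫ ω, ξ ω s * ξ ω u ∂Q := by
    have hadd : ∫ ω, (1 + S ω) ∂Q = 1 + ∫ ω, S ω ∂Q := by
      rw [integral_add (integrable_const _) hSi]
      simp
    rw [integral_add (f := fun ω => 1 + S ω) ((integrable_const _).add hSi) (hsqi.const_mul _),
      hadd, integral_const_mul, hsqint, hSint]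
  rw [← hpolyint, ← integral_sub hexp hpoly, ← Real.norm_eq_abs]
  have hbound := norm_integral_le_of_norm_le_const (μ := Q) (C := (∑ s, |a s|) ^ 3)
    (f := fun ω => Real.exp (S ω) - (1 + S ω + 1 / 2 * S ω ^ 2)) ?_
  · simpa using hbound
  filter_upwards [hSle] with ω hω
  have key := Real.exp_bound (hω.trans ha) (n := 3) (by norm_num)
  simp only [Finset.sum_range_succ, Finset.sum_range_zero, Nat.factorial] at key
  norm_num at key
  rw [Real.norm_eq_abs]
  calc |Real.exp (S ω) - (1 + S ω + 1 / 2 * S ω ^ 2)|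
      = |Real.exp (S ω) - (1 + S ω + S ω ^ 2 / 2)| := by congr 2; ring
    _ ≤ |S ω| ^ 3 * (2 / 9) := key
    _ ≤ |S ω| ^ 3 := by nlinarith [pow_nonneg (abs_nonneg (S ω)) 3]
    _ ≤ (∑ s, |a s|) ^ 3 := pow_le_pow_left₀ (abs_nonneg _) hω 3

/-- Second-order expansion of the cumulant generating function of a binary vector along a curve
`a` with a second-order expansion at the origin. -/
lemma isLittleO_log_integral_exp (hξ : Measurable ξ)
    (hbin : ∀ s, ∀ᵐ ω ∂Q, ξ ω s = 0 ∨ ξ ω s = 1) {a : T → ℝ → ℝ} {G U : T → ℝ}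
    (ha : ∀ s, (fun ε => a s ε - (G s * ε + U s / 2 * ε ^ 2)) =o[𝓝 0] fun ε : ℝ => ε ^ 2) :
    (fun ε => Real.log (∫ ω, Real.exp (∑ s, ξ ω s * a s ε) ∂Q)
      - ((∑ s, G s * ∫ ω, ξ ω s ∂Q) * ε
        + (1 / 2 * (∑ s, ∑ u, G s * (∫ ω, ξ ω s * ξ ω u ∂Q
            - (∫ ω, ξ ω s ∂Q) * ∫ ω, ξ ω u ∂Q) * G u)
          + 1 / 2 * ∑ s, U s * ∫ ω, ξ ω s ∂Q) * ε ^ 2))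
      =o[𝓝 0] fun ε : ℝ => ε ^ 2 := by
  set m : T → ℝ := fun s => ∫ ω, ξ ω s ∂Q
  set M : T → T → ℝ := fun s u => ∫ ω, ξ ω s * ξ ω u ∂Q
  have hlin s := isLittleO_linear_of_quadratic (ha s)
  have hO : (fun ε => ∑ s, |a s ε|) =O[𝓝 0] fun ε : ℝ => ε :=
    IsBigO.fun_sum fun s _ => (isBigO_id_of_isLittleO_linear (hlin s)).abs_left
  have hsmall : ∀ᶠ ε in 𝓝 (0 : ℝ), ∑ s, |a s ε| ≤ 1 :=
    (hO.trans_tendsto tendsto_id).eventually (Iic_mem_nhds zero_lt_one)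
  have hrem : (fun ε => ∫ ω, Real.exp (∑ s, ξ ω s * a s ε) ∂Q
      - (1 + ∑ s, a s ε * m s + 1 / 2 * ∑ s, ∑ u, a s ε * a u ε * M s u))
      =o[𝓝 0] fun ε : ℝ => ε ^ 2 := by
    have hcube : (fun ε : ℝ => ε ^ 3) =o[𝓝 0] fun ε : ℝ => ε ^ 2 :=
      isLittleO_pow_pow (by norm_num)
    refine IsBigO.trans_isLittleO (IsBigO.trans (IsBigO.of_bound 1 ?_) (hO.pow 3)) hcube
    filter_upwards [hsmall] with ε hε
    rw [one_mul, Real.norm_eq_abs]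
    exact (abs_integral_exp_sub_le hξ hbin _ hε).trans (le_abs_self _)
  have hfirst : (fun ε => ∑ s, (a s ε - (G s * ε + U s / 2 * ε ^ 2)) * m s)
      =o[𝓝 0] fun ε : ℝ => ε ^ 2 :=
    IsLittleO.fun_sum fun s _ => ((ha s).const_mul_left (m s)).congr_left fun ε => mul_comm _ _
  have hsecond : (fun ε => ∑ s, ∑ u, (a s ε * a u ε - G s * G u * ε ^ 2) * M s u)
      =o[𝓝 0] fun ε : ℝ => ε ^ 2 :=
    IsLittleO.fun_sum fun s _ => IsLittleO.fun_sum fun u _ =>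
      ((isLittleO_mul_sub_sq (hlin s) (hlin u)).const_mul_left (M s u)).congr_left
        fun ε => mul_comm _ _
  have hy : (fun ε => (∫ ω, Real.exp (∑ s, ξ ω s * a s ε) ∂Q - 1)
      - ((∑ s, G s * m s) * ε
        + (1 / 2 * ∑ s, U s * m s + 1 / 2 * ∑ s, ∑ u, G s * G u * M s u) * ε ^ 2))
      =o[𝓝 0] fun ε : ℝ => ε ^ 2 := by
    refine ((hrem.add hfirst).add (hsecond.const_mul_left (1 / 2))).congr_left fun ε => ?_
    have e₁ : ∑ s, (a s ε - (G s * ε + U s / 2 * ε ^ 2)) * m s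
        = ∑ s, a s ε * m s - ((∑ s, G s * m s) * ε + 1 / 2 * (∑ s, U s * m s) * ε ^ 2) := by
      simp only [Finset.sum_mul, Finset.mul_sum, ← Finset.sum_add_distrib,
        ← Finset.sum_sub_distrib]
      exact Finset.sum_congr rfl fun s _ => by ring
    have e₂ : ∑ s, ∑ u, (a s ε * a u ε - G s * G u * ε ^ 2) * M s u
        = ∑ s, ∑ u, a s ε * a u ε * M s u - (∑ s, ∑ u, G s * G u * M s u) * ε ^ 2 := by
      simp only [Finset.sum_mul, ← Finset.sum_sub_distrib]
      exact Finset.sum_congr rfl fun s _ => Finset.sum_congr rfl fun u _ => by ring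
    rw [e₁, e₂]
    ring
  refine (isLittleO_log_one_add hy).congr_left fun ε => ?_
  have e₃ : ∑ s, ∑ u, G s * (M s u - m s * m u) * G u
      = ∑ s, ∑ u, G s * G u * M s u - (∑ s, G s * m s) ^ 2 := by
    rw [sq, Finset.sum_mul_sum]
    simp only [← Finset.sum_sub_distrib]
    exact Finset.sum_congr rfl fun s _ => Finset.sum_congr rfl fun u _ => by ring
  rw [e₃, add_sub_cancel]
  ring

/-- On binary signals the log density splits into a constant and a linear form in the signal. -/
lemma log_integral_exp_of_binary (hξ : Measurable ξ)
    (hbin : ∀ s, ∀ᵐ ω ∂Q, ξ ω s = 0 ∨ ξ ω s = 1)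
    {h : ℝ → ℝ} {x : T → ℝ} {g : (T → ℝ) → ℝ}
    (hg : ∀ u : T → ℝ, g u = ∑ s, (u s + h (x s * Real.exp (u s)))) (ε : ℝ) :
    Real.log (∫ ω, Real.exp (g (ε • ξ ω)) ∂Q) = ∑ s, h (x s)
      + Real.log (∫ ω, Real.exp (∑ s, ξ ω s * (ε + h (x s * Real.exp ε) - h (x s))) ∂Q) := by
  have heq : ∫ ω, Real.exp (g (ε • ξ ω)) ∂Q = Real.exp (∑ s, h (x s))
      * ∫ ω, Real.exp (∑ s, ξ ω s * (ε + h (x s * Real.exp ε) - h (x s))) ∂Q := by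
    rw [← integral_const_mul]
    refine integral_congr_ae ?_
    filter_upwards [ae_all_iff.2 hbin] with ω hω
    rw [hg, ← Real.exp_add, ← Finset.sum_add_distrib]
    congr 1
    refine Finset.sum_congr rfl fun s _ => ?_
    rcases hω s with hs | hs <;> simp [hs]
  rw [heq, Real.log_mul (Real.exp_ne_zero _) (integral_exp_pos (integrable_exp_of_binary hξ hbin _)).ne',
    Real.log_exp]

end BinaryVector

/-- Example 2 (multiplicative noise): with
`g u = ∑ s, (u s + h (x s * exp (u s)))`, the conditional log-likelihood ratio
`r(ε) = ln(P(η_t=1)/P(η_t=0)) + ln E₁[exp (g (ε • η))] − ln E₀[exp (g (ε • η))]`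
has the expansion with `G(x) s = 1 + x s * h'(x s)` and
`U(x) s = x s * h'(x s) + (x s)² * h''(x s)`. -/
theorem cond_loglik_ratio_taylor_multiplicative_noise
    {T : Type*} [Fintype T] [Nonempty T]
    {Ω : Type*} [MeasurableSpace Ω] (P : Measure Ω) [IsProbabilityMeasure P]
    (η : Ω → T → ℝ) (hη : Measurable η)
    (hbin : ∀ t : T, ∀ᵐ ω ∂P, η ω t = 0 ∨ η ω t = 1)
    (t : T) (h0 : 0 < P {ω | η ω t = 1}) (h1 : P {ω | η ω t = 1} < 1)
    (h : ℝ → ℝ) (hh : ContDiff ℝ 2 h) (x : T → ℝ)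
    (g : (T → ℝ) → ℝ)
    (hg : ∀ u : T → ℝ, g u = ∑ s, (u s + h (x s * Real.exp (u s))))
    (G U : T → ℝ)
    (hG : ∀ s : T, G s = 1 + x s * deriv h (x s))
    (hU : ∀ s : T, U s = x s * deriv h (x s) + (x s) ^ 2 * deriv (deriv h) (x s)) :
    (fun ε : ℝ =>
        (Real.log ((P {ω | η ω t = 1}).toReal / (P {ω | η ω t = 0}).toReal)
          + Real.log (∫ ω, Real.exp (g (ε • η ω)) ∂(P[|{ω | η ω t = 1}]))
          - Real.log (∫ ω, Real.exp (g (ε • η ω)) ∂(P[|{ω | η ω t = 0}])))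
        - (Real.log ((P {ω | η ω t = 1}).toReal / (P {ω | η ω t = 0}).toReal)
          + (∑ s, G s * ((∫ ω, η ω s ∂(P[|{ω | η ω t = 1}]))
              - (∫ ω, η ω s ∂(P[|{ω | η ω t = 0}])))) * ε
          + (1 / 2) *
              (∑ s, ∑ u, G s *
                (((∫ ω, η ω s * η ω u ∂(P[|{ω | η ω t = 1}]))
                    - (∫ ω, η ω s ∂(P[|{ω | η ω t = 1}]))
                      * (∫ ω, η ω u ∂(P[|{ω | η ω t = 1}])))
                  - ((∫ ω, η ω s * η ω u ∂(P[|{ω | η ω t = 0}]))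
                    - (∫ ω, η ω s ∂(P[|{ω | η ω t = 0}]))
                      * (∫ ω, η ω u ∂(P[|{ω | η ω t = 0}])))) * G u)
              * ε ^ 2
          + (1 / 2) *
              (∑ s, U s * ((∫ ω, η ω s ∂(P[|{ω | η ω t = 1}]))
                - (∫ ω, η ω s ∂(P[|{ω | η ω t = 0}])))) * ε ^ 2))
      =o[𝓝 (0 : ℝ)] (fun ε : ℝ => ε ^ 2) := by
  have hA₁ : MeasurableSet {ω | η ω t = 1} :=
    measurable_pi_iff.1 hη t (measurableSet_singleton 1)
  have hP₀ : P {ω | η ω t = 0} ≠ 0 := by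
    intro hzero
    refine h1.ne ((mem_ae_iff_prob_eq_one hA₁).1 ?_)
    filter_upwards [hbin t, measure_eq_zero_iff_ae_notMem.1 hzero] with ω hω hω₀
    exact hω.resolve_left hω₀
  have hprob₁ : IsProbabilityMeasure (P[|{ω | η ω t = 1}]) := cond_isProbabilityMeasure h0.ne'
  have hprob₀ : IsProbabilityMeasure (P[|{ω | η ω t = 0}]) := cond_isProbabilityMeasure hP₀
  have hbin₁ s : ∀ᵐ ω ∂(P[|{ω | η ω t = 1}]), η ω s = 0 ∨ η ω s = 1 :=
    cond_absolutelyContinuous.ae_le (hbin s)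
  have hbin₀ s : ∀ᵐ ω ∂(P[|{ω | η ω t = 0}]), η ω s = 0 ∨ η ω s = 1 :=
    cond_absolutelyContinuous.ae_le (hbin s)
  have ha (s : T) : (fun ε => (ε + h (x s * Real.exp ε) - h (x s))
      - (G s * ε + U s / 2 * ε ^ 2)) =o[𝓝 0] fun ε : ℝ => ε ^ 2 := by
    rw [hG, hU]
    exact isLittleO_multiplicative_noise_increment hh (x s)
  refine ((isLittleO_log_integral_exp hη hbin₁ ha).sub
    (isLittleO_log_integral_exp hη hbin₀ ha)).congr_left fun ε => ?_
  rw [log_integral_exp_of_binary hη hbin₁ hg, log_integral_exp_of_binary hη hbin₀ hg]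
  simp only [mul_sub, sub_mul, Finset.sum_sub_distrib]
  ring
end
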